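/- Let a > b be two natural numbers. Let (([0,1]^a)^ℤ, σ) and (([0,1]^b)^ℤ, σ) be the full shifts on the alphabets [0,1]^a and [0,1]^b. Then for any equivariant continuous map π : ([0,1]^a)^ℤ → ([0,1]^b)^ℤ, the lower conditional metric mean dimension satisfies lower-mdim_M(π, σ, D) ≥ a − b, where D is the metric D((x_n), (y_n)) = Σ_{n∈ℤ} 2^{-|n|} ‖x_n − y_n‖_∞ on ([0,1]^a)^ℤ. -/

import Mathlib

open Filter Topology
open scoped ENNReal NNReal

noncomputable section

/-- Diameter (in `ℝ≥0∞`) of a set with respect to a distance function `ρ`. -/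
def setEDiam {X : Type*} (ρ : X → X → ℝ) (E : Set X) : ℝ≥0∞ :=
  ⨆ x ∈ E, ⨆ y ∈ E, ENNReal.ofReal (ρ x y)

/-- Openness with respect to a distance function `ρ`. -/
def ROpen {X : Type*} (ρ : X → X → ℝ) (U : Set X) : Prop :=
  ∀ x ∈ U, ∃ δ > 0, ∀ y, ρ x y < δ → y ∈ U

/-- `#(E, ρ, ε)`: the minimal number `n` of `ρ`-open sets of `ρ`-diameter `< ε` covering `E`
(`0` when `E = ∅`, since the empty family covers it). -/
def covNum {X : Type*} (ρ : X → X → ℝ) (ε : ℝ) (E : Set X) : ℕ :=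
  sInf {n : ℕ | ∃ U : Fin n → Set X, (∀ i, ROpen ρ (U i)) ∧
    (∀ i, setEDiam ρ (U i) < ENNReal.ofReal ε) ∧ E ⊆ ⋃ i, U i}

/-- The dynamical metric `d_N(x,y) = max_{0 ≤ n < N} d(Tⁿx, Tⁿy)`. -/
def dynDist {X : Type*} (T : X → X) (d : X → X → ℝ) (N : ℕ) (x y : X) : ℝ :=
  sSup {r : ℝ | ∃ n, n < N ∧ r = d (T^[n] x) (T^[n] y)}

/-- `sup_{y ∈ Y} log #(π⁻¹(y), ρ, ε)`. -/
def supLogCov {X Y : Type*} (π : X → Y) (ρ : X → X → ℝ) (ε : ℝ) : ℝ :=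
  ⨆ y : Y, Real.log (covNum ρ ε (π ⁻¹' {y}) : ℝ)

/-- `sup_{y ∈ Y} log #(π⁻¹(B_δ(y, ρY)), ρX, ε)` where `B_δ` is the closed `δ`-ball. -/
def supLogCovBall {X Y : Type*} (π : X → Y) (ρX : X → X → ℝ) (ρY : Y → Y → ℝ)
    (ε δ : ℝ) : ℝ :=
  ⨆ y : Y, Real.log (covNum ρX ε (π ⁻¹' {x | ρY x y ≤ δ}) : ℝ)

/-- Topological conditional entropy
`h_top(π, T) = lim_{ε→0} lim_{N→∞} (sup_y log #(π⁻¹(y), d_N, ε))/N`, as an extended real. -/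
def condEntropy {X Y : Type*} (π : X → Y) (T : X → X) (d : X → X → ℝ) : EReal :=
  Filter.limsup (fun ε : ℝ => Filter.liminf
      (fun N : ℕ => ((supLogCov π (dynDist T d N) ε / N : ℝ) : EReal)) Filter.atTop)
    (𝓝[>] (0 : ℝ))

/-- `lim_{N→∞} (sup_y log #(π⁻¹(y), d_N, ε))/(N log(1/ε))` (the limit exists by
subadditivity; it is realized here as a liminf). -/
def condMdimRate {X Y : Type*} (π : X → Y) (T : X → X) (d : X → X → ℝ) (ε : ℝ) : EReal :=
  Filter.liminf (fun N : ℕ =>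
    ((supLogCov π (dynDist T d N) ε / (N * Real.log (1 / ε)) : ℝ) : EReal)) Filter.atTop

/-- Lower conditional metric mean dimension of `π : (X,T,d) → Y`. -/
def lowerCondMdimM {X Y : Type*} (π : X → Y) (T : X → X) (d : X → X → ℝ) : EReal :=
  Filter.liminf (fun ε : ℝ => condMdimRate π T d ε) (𝓝[>] (0 : ℝ))

/-- Upper conditional metric mean dimension of `π : (X,T,d) → Y`. -/
def upperCondMdimM {X Y : Type*} (π : X → Y) (T : X → X) (d : X → X → ℝ) : EReal :=
  Filter.limsup (fun ε : ℝ => condMdimRate π T d ε) (𝓝[>] (0 : ℝ))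

/-- `lim_{N→∞} log #(X, d_N, ε)/(N log(1/ε))`. -/
def mdimMRate {X : Type*} (T : X → X) (d : X → X → ℝ) (ε : ℝ) : EReal :=
  Filter.liminf (fun N : ℕ =>
    ((Real.log (covNum (dynDist T d N) ε (Set.univ : Set X) : ℝ) /
      (N * Real.log (1 / ε)) : ℝ) : EReal)) Filter.atTop

/-- Lower metric mean dimension of `(X, T, d)`. -/
def lowerMdimM {X : Type*} (T : X → X) (d : X → X → ℝ) : EReal :=
  Filter.liminf (fun ε : ℝ => mdimMRate T d ε) (𝓝[>] (0 : ℝ))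

/-- Upper metric mean dimension of `(X, T, d)`. -/
def upperMdimM {X : Type*} (T : X → X) (d : X → X → ℝ) : EReal :=
  Filter.limsup (fun ε : ℝ => mdimMRate T d ε) (𝓝[>] (0 : ℝ))

/-- `widim_ε(X, ρ)`: the minimal `k` such that there are a finite simplicial complex of
dimension `≤ k` (realized in some `ℝ^m`) and a continuous `ε`-embedding `f : X → P`
(all fibers of `f` have `ρ`-diameter `< ε`). -/
def widim (X : Type*) [TopologicalSpace X] (ρ : X → X → ℝ) (ε : ℝ) : ℕ :=
  sInf {k : ℕ | ∃ (m : ℕ) (K : Geometry.SimplicialComplex ℝ (Fin m → ℝ)),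
    K.faces.Finite ∧ (∀ s ∈ K.faces, s.card ≤ k + 1) ∧
    ∃ f : X → K.space, Continuous f ∧
      ∀ p : K.space, setEDiam ρ (f ⁻¹' {p}) < ENNReal.ofReal ε}

/-- Mean dimension `mdim(X, T) = lim_{ε→0} lim_{N→∞} widim_ε(X, d_N)/N`. -/
def mdim (X : Type*) [TopologicalSpace X] (T : X → X) (d : X → X → ℝ) : EReal :=
  Filter.limsup (fun ε : ℝ => Filter.liminf
      (fun N : ℕ => (((widim X (dynDist T d N) ε : ℝ) / N : ℝ) : EReal)) Filter.atTop)
    (𝓝[>] (0 : ℝ))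

/-- The cube `[0,1]^a`. -/
abbrev Cube (a : ℕ) := Fin a → unitInterval

/-- The full shift space `([0,1]^a)^ℤ`. -/
abbrev FullShift (a : ℕ) := ℤ → Cube a

/-- The shift map `σ((x_n)_n) = (x_{n+1})_n`. -/
def shift {α : Type*} (x : ℤ → α) : ℤ → α := fun n => x (n + 1)

/-- The `ℓ^∞`-distance on the cube `[0,1]^a`. -/
def cubeDist {a : ℕ} (x y : Cube a) : ℝ :=
  ‖(fun i => (x i : ℝ)) - fun i => (y i : ℝ)‖

/-- The metric `D((x_n), (y_n)) = Σ_{n∈ℤ} 2^{-|n|} ‖x_n − y_n‖_∞` on the full shift. -/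
def shiftDist {a : ℕ} (x y : FullShift a) : ℝ :=
  ∑' n : ℤ, (2 : ℝ) ^ (-|n|) * cubeDist (x n) (y n)

end

section WaistInequality

open MeasureTheory

/-- Augmented simplicial chains mod 2 on all finite subsets of `α`. -/
abbrev Ch (α : Type*) := Finset α →₀ ZMod 2

namespace Ch
open scoped Classical in
/-- The boundary operator. -/
noncomputable def bd {α : Type*} : Ch α →ₗ[ZMod 2] Ch α :=
  Finsupp.lsum (ZMod 2) fun S => LinearMap.toSpanSingleton (ZMod 2) (Ch α)
    (∑ x ∈ S, Finsupp.single (S.erase x) 1)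

open scoped Classical in
/-- The cone operator with apex `b`. -/
noncomputable def cone {α : Type*} (b : α) : Ch α →ₗ[ZMod 2] Ch α :=
  Finsupp.lsum (ZMod 2) fun S => LinearMap.toSpanSingleton (ZMod 2) (Ch α)
    (if b ∈ S then 0 else Finsupp.single (insert b S) 1)

open scoped Classical in
/-- The chain map induced by a map of vertices. -/
noncomputable def push {α β : Type*} (a : α → β) : Ch α →ₗ[ZMod 2] Ch β :=
  Finsupp.lsum (ZMod 2) fun S => LinearMap.toSpanSingleton (ZMod 2) (Ch β)
    (if Set.InjOn a S then Finsupp.single (S.image a) 1 else 0)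

variable {α β : Type*}

open scoped Classical in
lemma bd_single (S : Finset α) : bd (Finsupp.single S 1) = ∑ x ∈ S, Finsupp.single (S.erase x) 1 := by
  simp [bd]

open scoped Classical in
lemma cone_single (b : α) (S : Finset α) :
    cone b (Finsupp.single S 1) = if b ∈ S then 0 else Finsupp.single (insert b S) 1 := by
  simp [cone]

open scoped Classical in
lemma push_single (a : α → β) (S : Finset α) :
    push a (Finsupp.single S 1) = if Set.InjOn a S then Finsupp.single (S.image a) 1 else 0 := by
  simp [push]

lemma add_self_eq (c : Ch α) : c + c = 0 := by
  ext S; simpa using CharTwo.add_self_eq_zero (c S)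

lemma ext_single {M : Type*} [AddCommMonoid M] [Module (ZMod 2) M] {f g : Ch α →ₗ[ZMod 2] M}
    (h : ∀ S, f (Finsupp.single S 1) = g (Finsupp.single S 1)) : f = g := by
  ext S; simpa using h S

open scoped Classical in
lemma bd_cone_single (b : α) (S : Finset α) :
    bd (cone b (Finsupp.single S 1)) + cone b (bd (Finsupp.single S 1)) = Finsupp.single S 1 := by
  rw [cone_single, bd_single, map_sum]
  simp only [cone_single]
  split_ifs with hb
  · rw [map_zero, zero_add, Finset.sum_eq_single b]
    · simp [Finset.insert_erase hb]
    · intro x hx hxb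
      simp [hb, hxb.symm]
    · simp [hb]
  · rw [bd_single, Finset.sum_insert hb, Finset.erase_insert hb, add_assoc]
    have : ∑ x ∈ S, Finsupp.single ((insert b S).erase x) (1 : ZMod 2)
        = ∑ x ∈ S, if b ∈ S.erase x then 0 else Finsupp.single (insert b (S.erase x)) 1 := by
      refine Finset.sum_congr rfl fun x hx => ?_
      have hxb : b ≠ x := fun h => hb (h ▸ hx)
      rw [if_neg (fun h => hb (Finset.mem_of_mem_erase h)), Finset.erase_insert_of_ne hxb]
    rw [this, add_self_eq, add_zero]

lemma bd_cone (b : α) (c : Ch α) : bd (cone b c) + cone b (bd c) = c := by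
  have : bd ∘ₗ cone b + cone b ∘ₗ bd = LinearMap.id := ext_single fun S => by
    simpa using bd_cone_single b S
  simpa using LinearMap.congr_fun this c

lemma bd_cone' (b : α) (c : Ch α) : bd (cone b c) = c + cone b (bd c) := by
  conv_rhs => enter [1]; rw [← bd_cone b c]
  rw [add_assoc, add_self_eq, add_zero]

open scoped Classical in
lemma bd_bd (c : Ch α) : bd (bd c) = 0 := by
  have : bd ∘ₗ bd = (0 : Ch α →ₗ[ZMod 2] Ch α) := ext_single fun S => by
    simp only [LinearMap.comp_apply, LinearMap.zero_apply]
    induction S using Finset.induction_on with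
    | empty => simp [bd_single]
    | insert b T hb ih =>
      have h1 : Finsupp.single (insert b T) (1 : ZMod 2) = cone b (Finsupp.single T 1) := by
        simp [cone_single, hb]
      rw [h1, bd_cone', map_add, bd_cone', ih, map_zero, add_zero, add_self_eq]
  simpa using LinearMap.congr_fun this c

open scoped Classical in
lemma bd_push_single (a : α → β) (S : Finset α) :
    bd (push a (Finsupp.single S 1)) = push a (bd (Finsupp.single S 1)) := by
  rw [push_single, bd_single, map_sum]
  simp only [push_single]
  split_ifs with h
  · rw [bd_single, Finset.sum_image h]
    refine Finset.sum_congr rfl fun x hx => ?_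
    rw [if_pos (h.mono (by simp))]
    congr 1
    ext y
    simp only [Finset.mem_erase, Finset.mem_image]
    constructor
    · rintro ⟨hy, z, hz, rfl⟩
      exact ⟨z, ⟨fun e => hy (e ▸ rfl), hz⟩, rfl⟩
    · rintro ⟨z, ⟨hzx, hz⟩, rfl⟩
      exact ⟨fun e => hzx (h hz hx e), z, hz, rfl⟩
  · rw [map_zero]
    simp only [Set.InjOn, not_forall] at h
    obtain ⟨x, hx, y, hy, hxy, hne⟩ := h
    have hx' : x ∈ S := hx
    have hy' : y ∈ S := hy
    symm
    rw [← Finset.sum_subset (Finset.insert_subset hx' (Finset.singleton_subset_iff.2 hy')) (f := fun x =>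
      if Set.InjOn a ↑(S.erase x) then Finsupp.single (Finset.image a (S.erase x)) (1 : ZMod 2) else 0),
      Finset.sum_pair hne]
    · have himg : ∀ u v, u ∈ S → v ∈ S → u ≠ v → a u = a v → (S.erase u).image a = S.image a := by
        intro u v hu hv huv h
        ext w
        simp only [Finset.mem_erase, Finset.mem_image]
        constructor
        · rintro ⟨z, hz, rfl⟩; exact ⟨z, hz.2, rfl⟩
        · rintro ⟨z, hz, rfl⟩
          by_cases hzu : z = u
          · exact ⟨v, ⟨huv.symm, hv⟩, by rw [hzu, h]⟩
          · exact ⟨z, ⟨hzu, hz⟩, rfl⟩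
      have e1 := himg x y hx' hy' hne hxy
      have e2 := himg y x hy' hx' (Ne.symm hne) hxy.symm
      have hiff : Set.InjOn a ↑(S.erase x) ↔ Set.InjOn a ↑(S.erase y) := by
        rw [← Finset.card_image_iff, ← Finset.card_image_iff, e1, e2,
          Finset.card_erase_of_mem hx', Finset.card_erase_of_mem hy']
      simp only [e1, e2, hiff, add_self_eq]
    · intro z _ hz
      simp only [Finset.mem_insert, Finset.mem_singleton, not_or] at hz
      rw [if_neg]
      intro hinj
      exact hne (hinj (Finset.mem_coe.2 (Finset.mem_erase.2 ⟨Ne.symm hz.1, hx'⟩))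
        (Finset.mem_coe.2 (Finset.mem_erase.2 ⟨Ne.symm hz.2, hy'⟩)) hxy)

lemma bd_push (a : α → β) (c : Ch α) : bd (push a c) = push a (bd c) := by
  have : bd ∘ₗ push a = push a ∘ₗ bd := ext_single fun S => by
    simpa using bd_push_single a S
  simpa using LinearMap.congr_fun this c

open scoped Classical in
lemma push_cone {a : α → β} (ha : Function.Injective a) (b : α) (c : Ch α) :
    push a (cone b c) = cone (a b) (push a c) := by
  have : push a ∘ₗ cone b = cone (a b) ∘ₗ push a := ext_single fun S => by
    simp only [LinearMap.comp_apply, cone_single, push_single, ha.injOn, if_true]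
    split_ifs with h1 h2 h2
    · simp
    · exact absurd (Finset.mem_image_of_mem a h1) h2
    · obtain ⟨z, hz, e⟩ := Finset.mem_image.1 h2
      exact absurd (ha e ▸ hz) h1
    · simp [push_single, ha.injOn, Finset.image_insert]
  simpa using LinearMap.congr_fun this c

/-- A chain endomorphism of the augmented full complex on a finite set has trace zero. -/
lemma sum_coeff_eq_zero [Fintype α] [Nonempty α] (φ : Ch α →ₗ[ZMod 2] Ch α)
    (h : ∀ c, bd (φ c) = φ (bd c)) : ∑ S : Finset α, φ (Finsupp.single S 1) S = 0 := by
  classical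
  obtain ⟨b⟩ := ‹Nonempty α›
  have h0 : LinearMap.trace (ZMod 2) _ φ = ∑ S : Finset α, φ (Finsupp.single S 1) S := by
    rw [LinearMap.trace_eq_matrix_trace (ZMod 2) (Finsupp.basisSingleOne (R := ZMod 2) (ι := Finset α)),
      Matrix.trace]
    simp [LinearMap.toMatrix_apply]
  rw [← h0]
  have h1 : φ = φ * (bd * cone b) + φ * (cone b * bd) := by
    rw [← mul_add]
    ext1 S
    refine LinearMap.ext_ring ?_
    simp [bd_cone]
  have h2 : bd * φ = φ * bd := LinearMap.ext fun c => h c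
  rw [h1, map_add, ← mul_assoc, ← h2, mul_assoc, LinearMap.trace_mul_comm, ← mul_assoc]
  exact CharTwo.add_self_eq_zero _

end Ch

namespace Ch

/-- The barycenter of a finite set of points. -/
noncomputable def bary {E : Type*} [AddCommGroup E] [Module ℝ E] (S : Finset E) : E :=
  (S.card : ℝ)⁻¹ • ∑ x ∈ S, x

open scoped Classical in
/-- Barycentric subdivision of a single simplex, by recursion on the number of vertices. -/
noncomputable def sdAux {E : Type*} [AddCommGroup E] [Module ℝ E] : ℕ → Finset E → Ch E
  | 0, _ => Finsupp.single ∅ 1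
  | k + 1, S => cone (bary S) (∑ x ∈ S, sdAux k (S.erase x))

/-- Barycentric subdivision. -/
noncomputable def sd {E : Type*} [AddCommGroup E] [Module ℝ E] : Ch E →ₗ[ZMod 2] Ch E :=
  Finsupp.lsum (ZMod 2) fun S => LinearMap.toSpanSingleton (ZMod 2) (Ch E) (sdAux S.card S)

section
variable {E F : Type*} [AddCommGroup E] [Module ℝ E] [AddCommGroup F] [Module ℝ F]

lemma sd_single_empty : sd (Finsupp.single (∅ : Finset E) 1) = Finsupp.single ∅ 1 := by
  simp [sd, sdAux]

lemma sd_single {S : Finset E} (hS : S.Nonempty) :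
    sd (Finsupp.single S 1) = cone (bary S) (sd (bd (Finsupp.single S 1))) := by
  classical
  obtain ⟨k, hk⟩ : ∃ k, S.card = k + 1 := ⟨S.card - 1, by have := hS.card_pos; omega⟩
  rw [bd_single, map_sum]
  have h1 : sd (Finsupp.single S (1 : ZMod 2)) = sdAux S.card S := by simp [sd]
  rw [h1, hk, sdAux]
  congr 1
  refine Finset.sum_congr rfl fun x hx => ?_
  have : sd (Finsupp.single (S.erase x) (1 : ZMod 2)) = sdAux (S.erase x).card (S.erase x) := by
    simp [sd]
  rw [this, Finset.card_erase_of_mem hx, hk, Nat.add_sub_cancel]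

lemma bd_sd_single (k : ℕ) : ∀ S : Finset E, S.card = k →
    bd (sd (Finsupp.single S 1)) = sd (bd (Finsupp.single S 1)) := by
  classical
  induction k with
  | zero =>
    intro S hS
    rw [Finset.card_eq_zero.1 hS, sd_single_empty]
    simp [bd_single]
  | succ k ih =>
    intro S hS
    have hne : S.Nonempty := Finset.card_pos.1 (by omega)
    rw [sd_single hne, bd_cone']
    have : bd (sd (bd (Finsupp.single S (1 : ZMod 2)))) = 0 := by
      have h2 : bd (sd (bd (Finsupp.single S (1 : ZMod 2)))) = sd (bd (bd (Finsupp.single S 1))) := by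
        rw [bd_single, map_sum, map_sum, map_sum, map_sum]
        refine Finset.sum_congr rfl fun x hx => ih _ ?_
        rw [Finset.card_erase_of_mem hx, hS, Nat.add_sub_cancel]
      rw [h2, bd_bd, map_zero]
    rw [this, map_zero, add_zero]

lemma bd_sd (c : Ch E) : bd (sd c) = sd (bd c) := by
  have : bd ∘ₗ sd = sd ∘ₗ (bd : Ch E →ₗ[ZMod 2] Ch E) := ext_single fun S => by
    simpa using bd_sd_single _ S rfl
  simpa using LinearMap.congr_fun this c

lemma map_bary (f : E →ₗ[ℝ] F) (hf : Function.Injective f) [DecidableEq F] (S : Finset E) :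
    bary (S.image f) = f (bary S) := by
  simp only [bary, map_smul, map_sum, Finset.card_image_of_injective S hf]
  rw [Finset.sum_image hf.injOn]

lemma push_sd_single (f : E →ₗ[ℝ] F) (hf : Function.Injective f) (k : ℕ) : ∀ S : Finset E,
    S.card = k → push f (sd (Finsupp.single S 1)) = sd (push f (Finsupp.single S 1)) := by
  classical
  induction k with
  | zero =>
    intro S hS
    rw [Finset.card_eq_zero.1 hS, sd_single_empty, push_single]
    simp [sd_single_empty]
  | succ k ih =>
    intro S hS
    have hne : S.Nonempty := Finset.card_pos.1 (by omega)
    have h3 : push f (Finsupp.single S (1 : ZMod 2)) = Finsupp.single (S.image f) 1 := by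
      simp only [push_single, hf.injOn, if_true]
    rw [sd_single hne, push_cone hf, h3, sd_single (hne.image _), map_bary f hf, ← h3, bd_push]
    congr 1
    rw [bd_single, map_sum, map_sum, map_sum, map_sum]
    refine Finset.sum_congr rfl fun x hx => ih _ ?_
    rw [Finset.card_erase_of_mem hx, hS, Nat.add_sub_cancel]

lemma push_sd (f : E →ₗ[ℝ] F) (hf : Function.Injective f) (c : Ch E) :
    push f (sd c) = sd (push f c) := by
  have : push f ∘ₗ sd = sd ∘ₗ push f := ext_single fun S => by
    simpa using push_sd_single f hf _ S rfl
  simpa using LinearMap.congr_fun this c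

end

/-- The chains all of whose simplices satisfy `P`. -/
abbrev supp {α : Type*} (P : Finset α → Prop) : Submodule (ZMod 2) (Ch α) :=
  Finsupp.supported (ZMod 2) (ZMod 2) {T | P T}

lemma single_mem_supp {α : Type*} {P : Finset α → Prop} {S : Finset α} (h : P S) :
    Finsupp.single S 1 ∈ supp P := Finsupp.single_mem_supported _ _ h

lemma map_mem_supp {α β : Type*} {P : Finset α → Prop} {Q : Finset β → Prop}
    {f : Ch α →ₗ[ZMod 2] Ch β} (h : ∀ S, P S → f (Finsupp.single S 1) ∈ supp Q) {c : Ch α}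
    (hc : c ∈ supp P) : f c ∈ supp Q := by
  rw [supp, Finsupp.supported_eq_span_single] at hc
  induction hc using Submodule.span_induction with
  | mem x hx => obtain ⟨S, hS, rfl⟩ := hx; exact h S hS
  | zero => simp
  | add x y _ _ hx hy => rw [map_add]; exact add_mem hx hy
  | smul a x _ hx => rw [map_smul]; exact Submodule.smul_mem _ _ hx

section
variable {E : Type*} [NormedAddCommGroup E] [NormedSpace ℝ E]

/-- Simplices with at most `D` vertices in `C` and pairwise distances at most `δ`. -/
def Small (C : Set E) (D : ℕ) (δ : ℝ) (T : Finset E) : Prop :=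
  (T : Set E) ⊆ C ∧ T.card ≤ D ∧ ∀ x ∈ T, ∀ y ∈ T, dist x y ≤ δ

lemma bary_mem_convexHull {S : Finset E} (hS : S.Nonempty) : bary S ∈ convexHull ℝ (S : Set E) := by
  have h0 : (S.card : ℝ) ≠ 0 := by exact_mod_cast hS.card_pos.ne'
  rw [bary, Finset.smul_sum]
  refine (convex_convexHull ℝ _).sum_mem (fun _ _ => by positivity) ?_
    fun x hx => subset_convexHull ℝ _ hx
  rw [Finset.sum_const, nsmul_eq_mul, mul_inv_cancel₀ h0]

lemma dist_bary_le {S : Finset E} {D : ℕ} {δ : ℝ} (hδ : 0 ≤ δ) (hS : S.Nonempty) (hD : S.card ≤ D)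
    (h : ∀ x ∈ S, ∀ y ∈ S, dist x y ≤ δ) {v : E} (hv : v ∈ convexHull ℝ (S : Set E)) :
    dist v (bary S) ≤ (1 - (D : ℝ)⁻¹) * δ := by
  classical
  have hk : (0 : ℝ) < S.card := by exact_mod_cast hS.card_pos
  have hkD : (S.card : ℝ) ≤ D := by exact_mod_cast hD
  suffices (S : Set E) ⊆ Metric.closedBall (bary S) ((1 - (D : ℝ)⁻¹) * δ) from
    (convexHull_min this (convex_closedBall _ _) hv)
  intro w hw
  have hw' : w ∈ S := hw
  rw [Metric.mem_closedBall, dist_eq_norm]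
  have e : w - bary S = (S.card : ℝ)⁻¹ • ∑ x ∈ S.erase w, (w - x) := by
    have : ∑ x ∈ S, (w - x) = ∑ x ∈ S.erase w, (w - x) := by
      rw [← Finset.add_sum_erase _ _ hw', sub_self, zero_add]
    rw [← this, Finset.sum_sub_distrib, Finset.sum_const, smul_sub, ← Nat.cast_smul_eq_nsmul ℝ,
      smul_smul, inv_mul_cancel₀ hk.ne', one_smul, bary]
  rw [e, norm_smul, norm_inv, Real.norm_of_nonneg hk.le]
  have h1 : ‖∑ x ∈ S.erase w, (w - x)‖ ≤ ((S.card : ℝ) - 1) * δ := by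
    refine (norm_sum_le_of_le _ fun x hx => ?_).trans (b := ∑ x ∈ S.erase w, δ) ?_
    · rw [← dist_eq_norm]; exact h _ hw' _ (Finset.mem_of_mem_erase hx)
    · rw [Finset.sum_const, nsmul_eq_mul, Finset.card_erase_of_mem hw',
        Nat.cast_sub hS.card_pos, Nat.cast_one]
  calc (S.card : ℝ)⁻¹ * ‖∑ x ∈ S.erase w, (w - x)‖ ≤ (S.card : ℝ)⁻¹ * (((S.card : ℝ) - 1) * δ) := by
        gcongr
    _ = (1 - (S.card : ℝ)⁻¹) * δ := by field_simp
    _ ≤ _ := by gcongr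

lemma sd_single_mem (k : ℕ) {C : Set E} {D : ℕ} {δ : ℝ} (hδ : 0 ≤ δ) (hC : Convex ℝ C) :
    ∀ S : Finset E, S.card = k → Small C D δ S → sd (Finsupp.single S 1) ∈
      supp fun T => Small C D ((1 - (D : ℝ)⁻¹) * δ) T ∧ T.card ≤ S.card ∧
        (T : Set E) ⊆ convexHull ℝ (S : Set E) := by
  classical
  induction k with
  | zero =>
    intro S hS _
    rw [Finset.card_eq_zero.1 hS, sd_single_empty]
    exact single_mem_supp (by simp [Small])
  | succ k ih =>
    intro S hS hsm
    have hne : S.Nonempty := Finset.card_pos.1 (by omega)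
    rw [sd_single hne]
    have hθ : 0 ≤ (1 - (D : ℝ)⁻¹) * δ := by
      have : (1 : ℝ) ≤ D := by exact_mod_cast hne.card_pos.trans_le hsm.2.1
      have : (D : ℝ)⁻¹ ≤ 1 := inv_le_one_of_one_le₀ this
      exact mul_nonneg (by linarith) hδ
    have hbh := bary_mem_convexHull hne
    have hSC : convexHull ℝ (S : Set E) ⊆ C := convexHull_min hsm.1 hC
    refine map_mem_supp (P := fun T => Small C D ((1 - (D : ℝ)⁻¹) * δ) T ∧ T.card ≤ k ∧
        (T : Set E) ⊆ convexHull ℝ (S : Set E)) ?_ ?_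
    · rintro T ⟨⟨h1, h2, h3⟩, h4, h5⟩
      rw [cone_single]
      split_ifs with hb
      · exact zero_mem _
      · refine single_mem_supp ⟨⟨?_, ?_, ?_⟩, ?_, ?_⟩
        · rw [Finset.coe_insert]; exact Set.insert_subset (hSC hbh) h1
        · exact (Finset.card_insert_le _ _).trans (by have := hsm.2.1; omega)
        · intro x hx y hy
          rcases Finset.mem_insert.1 hx with rfl | hx <;> rcases Finset.mem_insert.1 hy with rfl | hy
          · simpa using hθ
          · rw [dist_comm]; exact dist_bary_le hδ hne hsm.2.1 hsm.2.2 (h5 hy)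
          · exact dist_bary_le hδ hne hsm.2.1 hsm.2.2 (h5 hx)
          · exact h3 x hx y hy
        · exact (Finset.card_insert_le _ _).trans (by omega)
        · rw [Finset.coe_insert]; exact Set.insert_subset hbh h5
    · rw [bd_single, map_sum]
      refine sum_mem fun x hx => ?_
      have hc : (S.erase x).card = k := by rw [Finset.card_erase_of_mem hx, hS, Nat.add_sub_cancel]
      have hsub : S.erase x ⊆ S := Finset.erase_subset _ _
      refine Finsupp.supported_mono ?_ (ih (S.erase x) hc ⟨?_, ?_, ?_⟩)
      · rintro T ⟨h1, h2, h3⟩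
        exact ⟨h1, h2.trans hc.le, h3.trans (convexHull_mono (by exact_mod_cast hsub))⟩
      · exact Set.Subset.trans (by exact_mod_cast hsub) hsm.1
      · exact (Finset.card_le_card hsub).trans hsm.2.1
      · exact fun a ha b hb => hsm.2.2 a (hsub ha) b (hsub hb)

lemma sd_mem {C : Set E} {D : ℕ} {δ : ℝ} (hδ : 0 ≤ δ) (hC : Convex ℝ C) {c : Ch E}
    (hc : c ∈ supp (Small C D δ)) : sd c ∈ supp (Small C D ((1 - (D : ℝ)⁻¹) * δ)) :=
  map_mem_supp (fun S hS => Finsupp.supported_mono (fun _ hT => hT.1)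
    (sd_single_mem _ hδ hC S rfl hS)) hc

lemma sd_pow_mem {C : Set E} {D : ℕ} (hD : 1 ≤ D) {δ : ℝ} (hδ : 0 ≤ δ) (hC : Convex ℝ C) {c : Ch E}
    (hc : c ∈ supp (Small C D δ)) (K : ℕ) :
    (sd ^ K) c ∈ supp (Small C D ((1 - (D : ℝ)⁻¹) ^ K * δ)) := by
  have : (0 : ℝ) ≤ 1 - (D : ℝ)⁻¹ := by
    have : (D : ℝ)⁻¹ ≤ 1 := inv_le_one_of_one_le₀ (by exact_mod_cast hD)
    linarith
  induction K with
  | zero => simpa using hc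
  | succ K ih =>
    have e : (sd ^ (K + 1)) c = sd ((sd ^ K) c) := by rw [pow_succ' sd]; rfl
    rw [e, pow_succ', mul_assoc]
    exact sd_mem (by positivity) hC ih

end
end Ch

namespace Ch
section
variable {α β γ : Type*}

lemma eq_of_mem_supp {M : Type*} [AddCommMonoid M] [Module (ZMod 2) M] {P : Finset α → Prop}
    {f g : Ch α →ₗ[ZMod 2] M} (h : ∀ S, P S → f (Finsupp.single S 1) = g (Finsupp.single S 1))
    {c : Ch α} (hc : c ∈ supp P) : f c = g c := by
  rw [supp, Finsupp.supported_eq_span_single] at hc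
  induction hc using Submodule.span_induction with
  | mem x hx => obtain ⟨S, hS, rfl⟩ := hx; exact h S hS
  | zero => simp
  | add x y _ _ hx hy => rw [map_add, map_add, hx, hy]
  | smul a x _ hx => rw [map_smul, map_smul, hx]

lemma push_push_single (g : β → γ) (f : α → β) (S : Finset α) :
    push g (push f (Finsupp.single S 1)) = push (g ∘ f) (Finsupp.single S 1) := by
  classical
  simp only [push_single]
  split_ifs with h1 h2 h2
  · rw [push_single, if_pos, Finset.image_image]
    rintro _ hx _ hy hxy
    simp only [Finset.coe_image, Set.mem_image] at hx hy
    obtain ⟨x, hx, rfl⟩ := hx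
    obtain ⟨y, hy, rfl⟩ := hy
    rw [h2 hx hy hxy]
  · rw [push_single, if_neg]
    exact fun h => h2 (fun x hx y hy e => h1 hx hy (h (by simpa using ⟨x, hx, rfl⟩)
      (by simpa using ⟨y, hy, rfl⟩) e))
  · exact absurd (fun x hx y hy e => h2 hx hy (congrArg g e)) h1
  · simp

lemma push_push (g : β → γ) (f : α → β) (c : Ch α) : push g (push f c) = push (g ∘ f) c := by
  have : push g ∘ₗ push f = push (g ∘ f) := ext_single fun S => by
    simpa using push_push_single g f S
  simpa using LinearMap.congr_fun this c

lemma push_single_congr {f g : α → β} {S : Finset α} (h : Set.EqOn f g S) :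
    push f (Finsupp.single S 1) = push g (Finsupp.single S 1) := by
  classical
  simp only [push_single, h.injOn_iff, Finset.image_congr h]

lemma push_apply_image [DecidableEq β] {f : α → β} (hf : Function.Injective f) (c : Ch α)
    (S : Finset α) : push f c (S.image f) = c S := by
  classical
  have : Finsupp.lapply (R := ZMod 2) (S.image f) ∘ₗ push f = Finsupp.lapply S :=
    ext_single fun T => by
      have h : (T.image f = S.image f) = (T = S) := propext (Finset.image_injective hf).eq_iff
      simp only [LinearMap.comp_apply, push_single, hf.injOn, if_true, Finsupp.lapply_apply,
        Finsupp.single_apply]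
      convert rfl using 2
      rw [← h]
      constructor <;> intro h <;> convert h
  simpa using LinearMap.congr_fun this c

end
end Ch

/-- The involution attached to a node `ν`: change the sign of the coordinates at `ν` and permute
the other coordinates by `π ν`. -/
def nodeFlip {N κ R : Type*} [DecidableEq N] [Neg R] (π : N → N → N) (ν : N) (x : N × κ → R) :
    N × κ → R := fun p => if p.1 = ν then -x p else x (π ν p.1, p.2)

/-- Sign pattern of the dominant coordinates of a vector. -/
noncomputable def domSign {ι : Type*} [Fintype ι] (v : ι → ℝ) : ι → SignType :=
  fun k => if ‖v‖ / 2 ≤ |v k| then SignType.sign (v k) else 0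

/-- A sign vector seen as a real vector. -/
def signVec {ι : Type*} (v : ι → SignType) : ι → ℝ := fun k => (v k : ℝ)

lemma signVec_injective {ι : Type*} : Function.Injective (signVec (ι := ι)) := by
  intro v w h
  funext k
  have h := congrFun h k
  simp only [signVec] at h
  revert h
  cases v k <;> cases w k <;> norm_num

lemma signVec_mem {ι : Type*} [Fintype ι] (v : ι → SignType) :
    signVec v ∈ Metric.closedBall (0 : ι → ℝ) 1 := by
  rw [mem_closedBall_zero_iff, pi_norm_le_iff_of_nonneg zero_le_one]
  intro k
  simp only [signVec]
  cases v k <;> norm_num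

section
variable {N κ : Type*} [DecidableEq N] {π : N → N → N}

lemma nodeFlip_involutive {R : Type*} [InvolutiveNeg R] (hinv : ∀ ν μ, π ν (π ν μ) = μ)
    (hfix : ∀ ν, π ν ν = ν) (ν : N) : Function.Involutive (nodeFlip (κ := κ) (R := R) π ν) := by
  intro x
  funext p
  simp only [nodeFlip]
  split_ifs with h1 h2
  · simp
  · rw [← hinv ν p.1, h2, hfix] at h1; exact absurd rfl h1
  · rw [hinv]

lemma signVec_nodeFlip (ν : N) (v : N × κ → SignType) :
    signVec (nodeFlip π ν v) = nodeFlip π ν (signVec v) := by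
  funext p
  simp only [nodeFlip, signVec]
  split_ifs
  · simp
  · rfl

variable [Fintype N] [Fintype κ]

lemma norm_nodeFlip_le (ν : N) (x : N × κ → ℝ) : ‖nodeFlip π ν x‖ ≤ ‖x‖ := by
  rw [pi_norm_le_iff_of_nonneg (norm_nonneg _)]
  intro p
  simp only [nodeFlip]
  split_ifs
  · rw [norm_neg]; exact norm_le_pi_norm x p
  · exact norm_le_pi_norm x _

lemma norm_nodeFlip (hinv : ∀ ν μ, π ν (π ν μ) = μ)
    (hfix : ∀ ν, π ν ν = ν) (ν : N) (x : N × κ → ℝ) : ‖nodeFlip π ν x‖ = ‖x‖ := by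
  refine (norm_nodeFlip_le ν x).antisymm ?_
  conv_lhs => rw [← nodeFlip_involutive hinv hfix ν x]
  exact norm_nodeFlip_le ν _

lemma domSign_nodeFlip (hinv : ∀ ν μ, π ν (π ν μ) = μ)
    (hfix : ∀ ν, π ν ν = ν) (ν : N) (x : N × κ → ℝ) :
    domSign (nodeFlip π ν x) = nodeFlip π ν (domSign x) := by
  funext p
  simp only [domSign, norm_nodeFlip hinv hfix]
  simp only [nodeFlip, domSign]
  by_cases hp : p.1 = ν
  · simp only [hp, if_true, abs_neg, Left.sign_neg]
    split_ifs <;> simp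
  · simp [hp]

end

/-- `nodeFlip` on real vectors as a linear map. -/
def nodeFlipL {N κ : Type*} [DecidableEq N] (π : N → N → N) (ν : N) :
    (N × κ → ℝ) →ₗ[ℝ] (N × κ → ℝ) where
  toFun := nodeFlip π ν
  map_add' x y := by
    funext p; simp only [nodeFlip, Pi.add_apply]; split_ifs
    · ring
    · rfl
  map_smul' c x := by
    funext p; simp only [nodeFlip, Pi.smul_apply, smul_eq_mul, RingHom.id_apply]; split_ifs
    · ring
    · rfl

/-- All sign vectors of `S` share a nonzero sign in a coordinate at the node `ν`. -/
def NodeFacet {N κ : Type*} (ν : N) (S : Finset (N × κ → SignType)) : Prop :=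
  ∃ i : κ, ∃ σ : SignType, σ ≠ 0 ∧ ∀ v ∈ S, v (ν, i) = σ

lemma nodeFacet_image {N κ : Type*} [DecidableEq N] [DecidableEq (N × κ → SignType)]
    {π : N → N → N} (hfix : ∀ ν, π ν ν = ν) (ν μ : N) (S : Finset (N × κ → SignType)) :
    NodeFacet μ (S.image (nodeFlip π ν)) ↔ NodeFacet (π ν μ) S := by
  by_cases h : μ = ν
  · subst h
    rw [hfix]
    constructor
    · rintro ⟨i, σ, h0, h⟩
      refine ⟨i, -σ, by simpa using h0, fun v hv => ?_⟩
      have := h _ (Finset.mem_image_of_mem _ hv)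
      simp only [nodeFlip, if_true] at this
      rw [← this, neg_neg]
    · rintro ⟨i, σ, h0, h⟩
      refine ⟨i, -σ, by simpa using h0, ?_⟩
      simp only [Finset.mem_image]
      rintro _ ⟨v, hv, rfl⟩
      simp [nodeFlip, h v hv]
  · constructor
    · rintro ⟨i, σ, h0, h'⟩
      refine ⟨i, σ, h0, fun v hv => ?_⟩
      have := h' _ (Finset.mem_image_of_mem _ hv)
      simpa only [nodeFlip, if_neg h] using this
    · rintro ⟨i, σ, h0, h'⟩
      refine ⟨i, σ, h0, ?_⟩
      simp only [Finset.mem_image]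
      rintro _ ⟨v, hv, rfl⟩
      simpa only [nodeFlip, if_neg h] using h' v hv

/-- A function on sets of sign vectors that is invariant under the node flips on faces
has vanishing sum mod 2 over all nonempty sets lying in a facet. -/
lemma sum_nodeFacet_eq_zero {N κ : Type*} [Fintype N] [DecidableEq N] [Fintype κ] [DecidableEq κ]
    {π : N → N → N} {rank : N → ℕ} (hinv : ∀ ν μ, π ν (π ν μ) = μ)
    (hinj : Function.Injective rank) (hrank : ∀ ν μ, rank μ ≤ rank ν → π ν μ = μ)
    (f : Finset (N × κ → SignType) → ZMod 2)
    (hf : ∀ ν S S', NodeFacet ν S → (∀ w, w ∈ S' ↔ ∃ v ∈ S, nodeFlip π ν v = w) → f S' = f S)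
    (hf' : ∀ S, S.Nonempty → f S ≠ 0 → ∃ ν, NodeFacet ν S) :
    ∑ S, f S = f ∅ := by
  classical
  have hfix : ∀ ν, π ν ν = ν := fun ν => hrank ν ν le_rfl
  have hm : ∀ S : Finset (N × κ → SignType), (∃ ν, NodeFacet ν S) →
      ∃ ν, NodeFacet ν S ∧ ∀ μ, NodeFacet μ S → rank ν ≤ rank μ := by
    rintro S ⟨ν, hν⟩
    obtain ⟨ν, h1, h2⟩ := Finset.exists_min_image (Finset.univ.filter fun ν => NodeFacet ν S) rank
      ⟨ν, by simpa using hν⟩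
    exact ⟨ν, by simpa using h1, fun μ hμ => h2 μ (by simpa using hμ)⟩
  rcases isEmpty_or_nonempty N with hN | hN
  · refine Finset.sum_eq_single ∅ (fun S _ hS => ?_) (by simp)
    by_contra h
    obtain ⟨ν, -⟩ := hf' S (Finset.nonempty_iff_ne_empty.2 hS) h
    exact hN.elim ν
  choose! m hm1 hm2 using hm
  rw [← Finset.add_sum_erase _ _ (Finset.mem_univ ∅)]
  have h0 : ∑ S ∈ Finset.univ.filter (fun S : Finset (N × κ → SignType) =>
      S.Nonempty ∧ ∃ ν, NodeFacet ν S), f S = 0 := by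
    have hmem : ∀ S : Finset (N × κ → SignType), (∃ ν, NodeFacet ν S) →
        NodeFacet (m S) (S.image (nodeFlip π (m S))) := by
      intro S hS
      rw [nodeFacet_image hfix, hfix]
      exact hm1 S hS
    refine Finset.sum_involution (fun S _ => S.image (nodeFlip π (m S))) ?_ ?_ ?_ ?_
    · intro S hS
      simp only [Finset.mem_filter, Finset.mem_univ, true_and] at hS
      rw [hf _ S _ (hm1 S hS.2) (fun w => Finset.mem_image)]
      exact CharTwo.add_self_eq_zero _
    · intro S hS _ he
      simp only [Finset.mem_filter, Finset.mem_univ, true_and] at hS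
      obtain ⟨⟨v, hv⟩, hS2⟩ := hS
      obtain ⟨i, σ, h0, h⟩ := hm1 S hS2
      have h1 := h v hv
      have h2 := h (nodeFlip π (m S) v) (by
        have : nodeFlip π (m S) v ∈ S.image (nodeFlip π (m S)) := Finset.mem_image_of_mem _ hv
        rwa [he] at this)
      simp only [nodeFlip, if_true, h1] at h2
      revert h0 h2
      cases σ <;> decide
    · intro S hS
      simp only [Finset.mem_filter, Finset.mem_univ, true_and] at hS ⊢
      exact ⟨hS.1.image _, _, hmem S hS.2⟩
    · intro S hS
      simp only [Finset.mem_filter, Finset.mem_univ, true_and] at hS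
      have hme := hmem S hS.2
      have : m (S.image (nodeFlip π (m S))) = m S := by
        set ν := m S with hν
        have hex : ∃ μ, NodeFacet μ (S.image (nodeFlip π ν)) := ⟨_, hme⟩
        refine hinj (le_antisymm (hm2 _ hex _ hme) ?_)
        have h3 := hm1 _ hex
        rw [nodeFacet_image hfix] at h3
        by_contra hlt
        rw [hrank _ _ (not_le.1 hlt).le] at h3
        exact hlt (hm2 S hS.2 _ h3)
      simp only [this]
      rw [Finset.image_image, (nodeFlip_involutive hinv hfix _).comp_self, Finset.image_id]
  have h1 : ∑ S ∈ Finset.univ.erase ∅, f S = 0 := by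
    rw [← h0]
    symm
    refine Finset.sum_subset ?_ ?_
    · intro S hS
      simp only [Finset.mem_filter, Finset.mem_univ, true_and] at hS
      simpa using hS.1.ne_empty
    · intro S hS hS'
      simp only [Finset.mem_filter, Finset.mem_univ, true_and, not_and] at hS'
      have hne : S.Nonempty := Finset.nonempty_iff_ne_empty.2 (by simpa using hS)
      by_contra h
      exact hS' hne (hf' S hne h)
  rw [h1, add_zero]

lemma exists_common_domSign {ι : Type*} [Fintype ι] {η : ℝ} (hη : 0 < η) {T : Finset (ι → ℝ)}
    (hT : T.Nonempty) (h1 : ∀ x ∈ T, η ≤ ‖x‖) (h2 : ∀ x ∈ T, ∀ y ∈ T, dist x y ≤ η / 3) :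
    ∃ k, ∃ σ : SignType, σ ≠ 0 ∧ ∀ x ∈ T, domSign x k = σ := by
  obtain ⟨x, hx⟩ := hT
  have hx0 := hη.trans_le (h1 x hx)
  obtain ⟨k, hk⟩ : ∃ k, ‖x‖ ≤ |x k| := by
    by_contra! h
    exact lt_irrefl _ ((pi_norm_lt_iff hx0).2 h)
  refine ⟨k, SignType.sign (x k), ?_, fun y hy => ?_⟩
  · rw [Ne, sign_eq_zero_iff]
    intro h; rw [h, abs_zero] at hk; linarith
  · have hxy := h2 x hx y hy
    have h3 : ‖y‖ ≤ ‖x‖ + η / 3 := by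
      have := norm_sub_norm_le y x
      rw [← dist_eq_norm, dist_comm] at this
      linarith
    have h4 : |x k - y k| ≤ η / 3 := by
      rw [← Real.dist_eq]; exact (dist_le_pi_dist x y k).trans hxy
    have h5 := h1 x hx
    have h6 : ‖y‖ / 2 ≤ |y k| := by
      have := abs_sub_abs_le_abs_sub (x k) (y k)
      linarith
    rw [domSign, if_pos h6]
    rw [abs_le] at h4
    rcases lt_trichotomy (x k) 0 with hlt | h0 | hgt
    · rw [abs_of_neg hlt] at hk
      rw [sign_neg hlt, sign_neg (by linarith)]
    · rw [h0, abs_zero] at hk; linarith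
    · rw [abs_of_pos hgt] at hk
      rw [sign_pos hgt, sign_pos (by linarith)]

open Ch in
/-- A map of the cube that commutes with the node flips on the corresponding faces has a zero. -/
theorem exists_zero_of_nodeFlip {N κ : Type*} [Fintype N] [DecidableEq N] [Fintype κ]
    {π : N → N → N} {rank : N → ℕ} (hinv : ∀ ν μ, π ν (π ν μ) = μ)
    (hinj : Function.Injective rank) (hrank : ∀ ν μ, rank μ ≤ rank ν → π ν μ = μ)
    (Ψ : (N × κ → ℝ) → (N × κ → ℝ)) (hΨ : ContinuousOn Ψ (Metric.closedBall 0 1))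
    (hodd : ∀ x ∈ Metric.closedBall (0 : N × κ → ℝ) 1, ∀ ν i, |x (ν, i)| = 1 →
      Ψ (nodeFlip π ν x) = nodeFlip π ν (Ψ x)) :
    ∃ x ∈ Metric.closedBall (0 : N × κ → ℝ) 1, Ψ x = 0 := by
  classical
  by_contra! hno
  have hfix : ∀ ν, π ν ν = ν := fun ν => hrank ν ν le_rfl
  set Q := Metric.closedBall (0 : N × κ → ℝ) 1 with hQ
  have hQc : IsCompact Q := isCompact_closedBall _ _
  obtain ⟨x₀, hx₀, hmin⟩ := hQc.exists_isMinOn ⟨0, by simp [hQ]⟩ hΨ.norm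
  set η := ‖Ψ x₀‖
  have hη : 0 < η := norm_pos_iff.2 (hno x₀ hx₀)
  have huc := hQc.uniformContinuousOn_of_continuous hΨ
  obtain ⟨δ, hδ, hδ'⟩ := Metric.uniformContinuousOn_iff.1 huc (η / 3) (by positivity)
  set D := Fintype.card (N × κ → SignType) with hD
  have hD1 : 1 ≤ D := Fintype.card_pos
  have hθ0 : (0 : ℝ) ≤ 1 - (D : ℝ)⁻¹ := by
    have : (D : ℝ)⁻¹ ≤ 1 := inv_le_one_of_one_le₀ (by exact_mod_cast hD1)
    linarith
  have hθ1 : 1 - (D : ℝ)⁻¹ < 1 := by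
    have : (0 : ℝ) < (D : ℝ)⁻¹ := by positivity
    linarith
  obtain ⟨K, hK⟩ := exists_pow_lt_of_lt_one (show 0 < δ / 2 by positivity) hθ1
  set a : (N × κ → ℝ) → (N × κ → SignType) := domSign ∘ Ψ
  let φ : Ch (N × κ → SignType) →ₗ[ZMod 2] Ch (N × κ → SignType) :=
    push a ∘ₗ (sd ^ K : Ch (N × κ → ℝ) →ₗ[ZMod 2] Ch (N × κ → ℝ)) ∘ₗ push signVec
  have hφ : ∀ c, φ c = push a ((sd ^ K : Ch (N × κ → ℝ) →ₗ[ZMod 2] Ch (N × κ → ℝ))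
      (push signVec c)) := fun c => rfl
  have hsdbd : ∀ (k : ℕ) (c : Ch (N × κ → ℝ)), bd ((sd ^ k) c) = (sd ^ k) (bd c) := by
    intro k
    induction k with
    | zero => intro c; rfl
    | succ k ih =>
      intro c
      have e : ∀ c : Ch (N × κ → ℝ), (sd ^ (k + 1)) c = sd ((sd ^ k) c) := by
        intro c; rw [pow_succ' sd]; rfl
      rw [e, e, bd_sd, ih]
  have hsdF : ∀ (ν : N) (k : ℕ) (c : Ch (N × κ → ℝ)),
      (sd ^ k) (push (nodeFlip π ν) c) = push (nodeFlip π ν) ((sd ^ k) c) := by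
    intro ν k
    induction k with
    | zero => intro c; rfl
    | succ k ih =>
      intro c
      have e : ∀ c : Ch (N × κ → ℝ), (sd ^ (k + 1)) c = sd ((sd ^ k) c) := by
        intro c; rw [pow_succ' sd]; rfl
      rw [e, e, ih]
      exact (push_sd (nodeFlipL π ν) (nodeFlip_involutive hinv hfix ν).injective _).symm
  have hchain : ∀ c, bd (φ c) = φ (bd c) := by
    intro c; rw [hφ, hφ, bd_push, hsdbd, bd_push]
  have hsum := sum_coeff_eq_zero φ hchain
  have hsupp : ∀ (S : Finset (N × κ → SignType)) (C : Set (N × κ → ℝ)), C ⊆ Q → Convex ℝ C →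
      (∀ v ∈ S, signVec v ∈ C) →
      (sd ^ K) (push signVec (Finsupp.single S 1)) ∈
        supp fun T => (T : Set (N × κ → ℝ)) ⊆ C ∧ ∀ x ∈ T, ∀ y ∈ T, dist x y < δ := by
    intro S C hCQ hC hSC
    have hstart : push signVec (Finsupp.single S (1 : ZMod 2)) ∈ supp (Small C D 2) := by
      rw [push_single, if_pos signVec_injective.injOn]
      refine single_mem_supp ⟨?_, ?_, ?_⟩
      · intro x hx
        simp only [Finset.coe_image, Set.mem_image] at hx
        obtain ⟨v, hv, rfl⟩ := hx
        exact hSC v hv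
      · exact (@Finset.card_image_le _ _ S signVec (Classical.decEq _)).trans (Finset.card_le_univ _)
      · intro x hx y hy
        simp only [Finset.mem_image] at hx hy
        obtain ⟨v, hv, rfl⟩ := hx
        obtain ⟨w, hw, rfl⟩ := hy
        have h1 := mem_closedBall_zero_iff.1 (signVec_mem v)
        have h2 := mem_closedBall_zero_iff.1 (signVec_mem w)
        rw [dist_eq_norm]
        linarith [norm_sub_le (signVec v) (signVec w)]
    refine Finsupp.supported_mono ?_ (sd_pow_mem hD1 zero_le_two hC hstart K)
    rintro T ⟨h1, h2, h3⟩
    exact ⟨h1, fun x hx y hy => (h3 x hx y hy).trans_lt (by linarith)⟩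
  have hmain := sum_nodeFacet_eq_zero hinv hinj hrank (fun S => φ (Finsupp.single S 1) S) ?_ ?_
  · rw [hsum] at hmain
    have : φ (Finsupp.single ∅ 1) = Finsupp.single ∅ 1 := by
      have e0 : ∀ {α β : Type _} (f : α → β), push f (Finsupp.single ∅ (1 : ZMod 2)) =
        Finsupp.single ∅ 1 := by intro α β f; simp [push_single]
      have e1 : ∀ k : ℕ, (sd ^ k) (Finsupp.single (∅ : Finset (N × κ → ℝ)) (1 : ZMod 2)) =
          Finsupp.single ∅ 1 := by
        intro k
        induction k with
        | zero => rfl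
        | succ k ih =>
          have e : ∀ c : Ch (N × κ → ℝ), (sd ^ (k + 1)) c = sd ((sd ^ k) c) := by
            intro c; rw [pow_succ' sd]; rfl
          rw [e, ih, sd_single_empty]
      rw [hφ, e0, e1, e0]
    simp [this] at hmain
  · rintro ν S S' ⟨i, σ, hσ, hS⟩ hS'
    obtain rfl : S' = S.image (nodeFlip π ν) := by ext w; rw [hS', Finset.mem_image]
    have hFi : Function.Injective (nodeFlip (κ := κ) (R := SignType) π ν) :=
      (nodeFlip_involutive hinv hfix ν).injective
    set C := {x ∈ Q | x (ν, i) = (σ : ℝ)} with hC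
    have hCconv : Convex ℝ C := by
      refine (convex_closedBall _ _).inter (fun x hx y hy s t _ _ hst => ?_)
      change x (ν, i) = (σ : ℝ) at hx
      change y (ν, i) = (σ : ℝ) at hy
      change s * x (ν, i) + t * y (ν, i) = (σ : ℝ)
      rw [hx, hy, ← add_mul, hst, one_mul]
    have hc := hsupp S C (fun x hx => hx.1) hCconv
      (fun v hv => ⟨signVec_mem v, by simp [signVec, hS v hv]⟩)
    have h1 : Finsupp.single (S.image (nodeFlip π ν)) (1 : ZMod 2) =
        push (nodeFlip π ν) (Finsupp.single S 1) := by
      rw [push_single, if_pos hFi.injOn]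
      congr 1
      ext; simp
    have h2 : push signVec (push (nodeFlip π ν) (Finsupp.single S (1 : ZMod 2))) =
        push (nodeFlip π ν) (push signVec (Finsupp.single S (1 : ZMod 2))) := by
      rw [push_push, push_push]
      congr 2
      funext v
      exact signVec_nodeFlip ν v
    have h3 : φ (Finsupp.single (S.image (nodeFlip π ν)) 1) =
        push (nodeFlip π ν) (φ (Finsupp.single S 1)) := by
      rw [hφ, hφ, h1, h2, hsdF]
      refine eq_of_mem_supp (f := push a ∘ₗ push (nodeFlip π ν))
        (g := push (nodeFlip π ν) ∘ₗ push a) ?_ hc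
      rintro T ⟨hT, _⟩
      rw [LinearMap.comp_apply, LinearMap.comp_apply, push_push, push_push]
      refine push_single_congr fun x hx => ?_
      obtain ⟨hxQ, hxi⟩ := hT hx
      simp only [a, Function.comp]
      rw [hodd x hxQ ν i, domSign_nodeFlip hinv hfix]
      rw [hxi]
      revert hσ
      cases σ <;> simp
    rw [h3]
    exact push_apply_image hFi _ S
  · intro S hSne hS
    have hmem : φ (Finsupp.single S 1) ∈ supp fun U => U.Nonempty → ∃ ν, NodeFacet ν U := by
      rw [hφ]
      refine map_mem_supp ?_ (hsupp S Q le_rfl (convex_closedBall _ _) fun v _ => signVec_mem v)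
      rintro T ⟨hT1, hT2⟩
      rw [push_single]
      split_ifs with hT
      · refine single_mem_supp fun hne => ?_
        have hTne : T.Nonempty := by simpa using hne
        obtain ⟨⟨ν, i⟩, σ, h0, h⟩ := exists_common_domSign hη (hTne.image Ψ) (by
            simp only [Finset.mem_image]
            rintro _ ⟨x, hx, rfl⟩
            exact hmin (hT1 hx)) (by
            simp only [Finset.mem_image]
            rintro _ ⟨x, hx, rfl⟩ _ ⟨y, hy, rfl⟩
            exact (hδ' x (hT1 hx) y (hT1 hy) (hT2 x hx y hy)).le)
        refine ⟨ν, i, σ, h0, ?_⟩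
        simp only [Finset.mem_image]
        rintro _ ⟨x, hx, rfl⟩
        exact h _ (Finset.mem_image_of_mem _ hx)
      · exact zero_mem _
    exact hmem (Finsupp.mem_support_iff.2 hS) hSne

lemma volume_add_le_aux {A B C : Set ℝ} (hA : IsCompact A) (hB : IsCompact B) (hA' : A.Nonempty)
    (hB' : B.Nonempty) (h : ∀ x ∈ A, ∀ y ∈ B, x + y ∈ C) : volume A + volume B ≤ volume C := by
  obtain ⟨a, ha, ha'⟩ := hA.exists_isGreatest hA'
  obtain ⟨b, hb, hb'⟩ := hB.exists_isLeast hB'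
  have h1 : volume ((fun x => x + b) '' A) = volume A := by
    rw [Set.image_add_right, measure_preimage_add_right]
  have h2 : volume ((fun x => a + x) '' B) = volume B := by
    rw [Set.image_add_left, measure_preimage_add]
  have hm : MeasurableSet ((fun x => a + x) '' B) :=
    (hB.image (continuous_const.add continuous_id)).measurableSet
  rw [← h1, ← h2, ← measure_union₀ hm.nullMeasurableSet]
  · refine measure_mono ?_
    rintro _ (⟨x, hx, rfl⟩ | ⟨x, hx, rfl⟩)
    · exact h x hx b hb
    · exact h a ha x hx
  · refine measure_mono_null (t := {a + b}) ?_ (by simp)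
    rintro _ ⟨⟨x, hx, rfl⟩, ⟨y, hy, he⟩⟩
    have h3 := ha' hx
    have h4 := hb' hy
    simp only at he
    simp only [Set.mem_singleton_iff]
    linarith

/-- The one-dimensional Brunn-Minkowski inequality. -/
lemma volume_add_le {A B C : Set ℝ} (hA : MeasurableSet A) (hB : MeasurableSet B)
    (hA' : A.Nonempty) (hB' : B.Nonempty) (h : ∀ x ∈ A, ∀ y ∈ B, x + y ∈ C) :
    volume A + volume B ≤ volume C := by
  obtain ⟨a, ha⟩ := hA'
  obtain ⟨b, hb⟩ := hB'
  rw [hA.measure_eq_iSup_isCompact, hB.measure_eq_iSup_isCompact]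
  simp only [iSup_and']
  refine ENNReal.biSup_add_biSup_le' (p := fun K => K ⊆ A ∧ IsCompact K)
    (q := fun L => L ⊆ B ∧ IsCompact L) ⟨∅, by simp⟩ ⟨∅, by simp⟩ ?_
  rintro K ⟨hKA, hK⟩ L ⟨hLB, hL⟩
  refine (add_le_add (measure_mono (Set.subset_insert a K))
    (measure_mono (Set.subset_insert b L))).trans ?_
  refine volume_add_le_aux (hK.insert a) (hL.insert b) (Set.insert_nonempty _ _)
    (Set.insert_nonempty _ _) fun x hx y hy => h x ?_ y ?_
  · exact Set.insert_subset ha hKA hx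
  · exact Set.insert_subset hb hLB hy

lemma ENNReal.geom_mean_le {t : ℝ} (h0 : 0 < t) (h1 : t < 1) (p q : ℝ≥0∞) :
    p ^ (1 - t) * q ^ t ≤ ENNReal.ofReal (1 - t) * p + ENNReal.ofReal t * q := by
  have ht : 0 < 1 - t := by linarith
  rcases eq_or_ne p ∞ with rfl | hp
  · refine le_top.trans_eq (Eq.symm ?_)
    rw [ENNReal.mul_top (by simpa using ht), top_add]
  rcases eq_or_ne q ∞ with rfl | hq
  · refine le_top.trans_eq (Eq.symm ?_)
    rw [ENNReal.mul_top (by simpa using h0), add_top]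
  lift p to ℝ≥0 using hp
  lift q to ℝ≥0 using hq
  have := NNReal.geom_mean_le_arith_mean2_weighted ⟨1 - t, ht.le⟩ ⟨t, h0.le⟩ p q
    (NNReal.eq (by change 1 - t + t = 1; ring))
  rw [← ENNReal.coe_rpow_of_nonneg _ ht.le, ← ENNReal.coe_rpow_of_nonneg _ h0.le]
  have e1 : ENNReal.ofReal (1 - t) = ((NNReal.mk (1 - t) ht.le : ℝ≥0) : ℝ≥0∞) :=
    ENNReal.ofReal_eq_coe_nnreal ht.le
  have e2 : ENNReal.ofReal t = ((NNReal.mk t h0.le : ℝ≥0) : ℝ≥0∞) := ENNReal.ofReal_eq_coe_nnreal h0.le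
  rw [e1, e2]
  exact_mod_cast this

lemma prekopa_leindler_one {t : ℝ} (h0 : 0 < t) (h1 : t < 1) {f g h : ℝ → ℝ≥0∞} {C : ℝ≥0∞}
    (hC : C ≠ ∞) (hf : Measurable f) (hg : Measurable g) (hh : Measurable h) (hfC : ∀ x, f x ≤ C)
    (hgC : ∀ x, g x ≤ C) (hfg : ∀ x y, f x ^ (1 - t) * g y ^ t ≤ h ((1 - t) * x + t * y)) :
    (∫⁻ x, f x) ^ (1 - t) * (∫⁻ x, g x) ^ t ≤ ∫⁻ x, h x := by
  have ht : 0 < 1 - t := by linarith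
  set a := ⨆ x, f x with ha
  set b := ⨆ x, g x with hb
  have haC : a ≠ ∞ := ((iSup_le hfC).trans_lt hC.lt_top).ne
  have hbC : b ≠ ∞ := ((iSup_le hgC).trans_lt hC.lt_top).ne
  rcases eq_or_ne a 0 with ha0 | ha0
  · have : ∀ x, f x = 0 := by simpa [ha] using ha0
    simp [this, ht]
  rcases eq_or_ne b 0 with hb0 | hb0
  · have : ∀ x, g x = 0 := by simpa [hb] using hb0
    simp [this, h0]
  set M := a ^ (1 - t) * b ^ t with hM
  have hM0 : M ≠ 0 := mul_ne_zero (by simp [ha0, haC]) (by simp [hb0, hbC])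
  have hMt : M ≠ ∞ := ENNReal.mul_ne_top (ENNReal.rpow_ne_top_of_nonneg ht.le haC)
    (ENNReal.rpow_ne_top_of_nonneg h0.le hbC)
  have layer : ∀ u : ℝ → ℝ≥0∞, Measurable u → (∀ x, u x ≤ 1) →
      ∫⁻ x, u x = ∫⁻ s in Set.Ioi (0 : ℝ), volume {x | s < (u x).toReal} := by
    intro u hu hu1
    rw [← lintegral_eq_lintegral_meas_lt _ (Eventually.of_forall fun x => ENNReal.toReal_nonneg)
      hu.ennreal_toReal.aemeasurable]
    refine lintegral_congr fun x => ?_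
    rw [ENNReal.ofReal_toReal ((hu1 x).trans_lt ENNReal.one_lt_top).ne]
  have hfa : ∀ x, f x / a ≤ 1 := fun x => ENNReal.div_le_of_le_mul (by
    rw [one_mul]; exact le_iSup f x)
  have hgb : ∀ x, g x / b ≤ 1 := fun x => ENNReal.div_le_of_le_mul (by
    rw [one_mul]; exact le_iSup g x)
  have key : ENNReal.ofReal (1 - t) * (∫⁻ x, f x / a) + ENNReal.ofReal t * (∫⁻ x, g x / b)
      ≤ ∫⁻ x, min (h x / M) 1 := by
    rw [layer _ (hf.div_const _) hfa, layer _ (hg.div_const _) hgb,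
      layer _ ((hh.div_const _).min measurable_const) (fun x => min_le_right _ _)]
    refine (add_le_add (lintegral_const_mul_le _ _) (lintegral_const_mul_le _ _)).trans
      ((le_lintegral_add _ _).trans ?_)
    refine setLIntegral_mono' measurableSet_Ioi fun s hs => ?_
    have hs0 : 0 < s := hs
    rcases le_or_gt 1 s with hs1 | hs1
    · have e1 : {x | s < (f x / a).toReal} = ∅ := by
        ext x
        have := ENNReal.toReal_mono ENNReal.one_ne_top (hfa x)
        simp only [ENNReal.toReal_one] at this
        simp only [Set.mem_ofPred_eq, Set.mem_empty_iff_false, iff_false, not_lt]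
        linarith
      have e2 : {x | s < (g x / b).toReal} = ∅ := by
        ext x
        have := ENNReal.toReal_mono ENNReal.one_ne_top (hgb x)
        simp only [ENNReal.toReal_one] at this
        simp only [Set.mem_ofPred_eq, Set.mem_empty_iff_false, iff_false, not_lt]
        linarith
      rw [e1, e2]; simp
    · have hset : ∀ (u : ℝ → ℝ≥0∞), (∀ x, u x ≤ 1) → {x | s < (u x).toReal} =
          {x | ENNReal.ofReal s < u x} := by
        intro u hu
        ext x
        simp only [Set.mem_ofPred_eq]
        rw [ENNReal.ofReal_lt_iff_lt_toReal hs0.le ((hu x).trans_lt ENNReal.one_lt_top).ne]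
      rw [hset _ hfa, hset _ hgb, hset _ (fun x => min_le_right _ _)]
      set S := ENNReal.ofReal s with hS
      have hS0 : S ≠ 0 := by simpa [hS] using hs0
      have hS1 : S < 1 := by rw [hS]; exact ENNReal.ofReal_lt_one.2 hs1
      have ne : ∀ (u : ℝ → ℝ≥0∞), (⨆ x, u x) ≠ 0 → (⨆ x, u x) ≠ ∞ →
          {x | S < u x / ⨆ x, u x}.Nonempty := by
        intro u hu0 hut
        have : S * (⨆ x, u x) < ⨆ x, u x := by
          conv_rhs => rw [← one_mul (⨆ x, u x)]
          exact ENNReal.mul_lt_mul_left hu0 hut hS1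
        obtain ⟨x, hx⟩ := lt_iSup_iff.1 this
        exact ⟨x, (ENNReal.lt_div_iff_mul_lt (Or.inl hu0) (Or.inl hut)).2 hx⟩
      have e3 := Measure.addHaar_smul (volume : Measure ℝ) (1 - t) {x | S < f x / a}
      have e4 := Measure.addHaar_smul (volume : Measure ℝ) t {x | S < g x / b}
      simp only [Module.finrank_self, pow_one, abs_of_pos ht, abs_of_pos h0] at e3 e4
      rw [← e3, ← e4]
      refine volume_add_le ((measurableSet_lt measurable_const (hf.div_const _)).const_smul₀ _)
        ((measurableSet_lt measurable_const (hg.div_const _)).const_smul₀ _)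
        ((ne f ha0 haC).smul_set) ((ne g hb0 hbC).smul_set) ?_
      rintro _ ⟨x, hx, rfl⟩ _ ⟨y, hy, rfl⟩
      simp only [smul_eq_mul, Set.mem_ofPred_eq] at hx hy ⊢
      refine lt_min ?_ hS1
      calc S = S ^ (1 - t) * S ^ t := by
            rw [← ENNReal.rpow_add _ _ hS0 (hS1.trans ENNReal.one_lt_top).ne]; simp
        _ < (f x / a) ^ (1 - t) * (g y / b) ^ t :=
            ENNReal.mul_lt_mul (ENNReal.rpow_lt_rpow hx ht) (ENNReal.rpow_lt_rpow hy h0)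
        _ = (f x ^ (1 - t) * g y ^ t) / M := by
            rw [ENNReal.div_rpow_of_nonneg _ _ ht.le, ENNReal.div_rpow_of_nonneg _ _ h0.le, hM,
              ENNReal.mul_div_mul_comm]
            · left; simp [haC, ha0]
            · left; simp [haC, ha0, ht]
        _ ≤ _ := by gcongr; exact hfg x y
  have hdiv : ∀ (u : ℝ → ℝ≥0∞) (c : ℝ≥0∞), Measurable u → ∫⁻ x, u x / c = (∫⁻ x, u x) / c := by
    intro u c hu
    simp only [div_eq_mul_inv]
    exact lintegral_mul_const _ hu
  have key2 : ((∫⁻ x, f x) / a) ^ (1 - t) * ((∫⁻ x, g x) / b) ^ t ≤ (∫⁻ x, h x) / M := by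
    refine (ENNReal.geom_mean_le h0 h1 _ _).trans ?_
    rw [← hdiv f a hf, ← hdiv g b hg, ← hdiv h M hh]
    exact key.trans (lintegral_mono fun x => min_le_left _ _)
  rw [ENNReal.div_rpow_of_nonneg _ _ ht.le, ENNReal.div_rpow_of_nonneg _ _ h0.le,
    ← ENNReal.mul_div_mul_comm (Or.inl (by simp [haC, ha0])) (Or.inl (by simp [haC, ha0, ht])),
    ← hM] at key2
  calc _ = _ / M * M := (ENNReal.div_mul_cancel hM0 hMt).symm
    _ ≤ _ := mul_le_mul_left key2 _
    _ = _ := ENNReal.div_mul_cancel hM0 hMt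

lemma lintegral_fin_succ {n : ℕ} {f : (Fin (n + 1) → ℝ) → ℝ≥0∞} (hf : Measurable f) :
    ∫⁻ x, f x = ∫⁻ x : ℝ, ∫⁻ y : Fin n → ℝ, f (Fin.cons x y) := by
  have h := (volume_preserving_piFinSuccAbove (fun _ : Fin (n + 1) => ℝ) 0).symm
  rw [← h.lintegral_comp hf, Measure.volume_eq_prod, lintegral_prod]
  · simp [MeasurableEquiv.piFinSuccAbove, Fin.insertNthEquiv]
  · exact (hf.comp h.measurable).aemeasurable

lemma measurable_fin_cons {n : ℕ} : Measurable fun q : ℝ × (Fin n → ℝ) => (Fin.cons q.1 q.2 :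
    Fin (n + 1) → ℝ) := by
  refine measurable_pi_lambda _ fun i => ?_
  refine Fin.cases ?_ (fun j => ?_) i
  · simpa using measurable_fst
  · simpa [Function.comp_def] using (measurable_pi_apply j).comp measurable_snd

/-- The Prékopa-Leindler inequality for bounded functions supported in a ball. -/
lemma prekopa_leindler {t : ℝ} (h0 : 0 < t) (h1 : t < 1) (R : ℝ) : ∀ {n : ℕ}
    {f g h : (Fin n → ℝ) → ℝ≥0∞} {C : ℝ≥0∞} (_ : C ≠ ∞) (_ : Measurable f) (_ : Measurable g)
    (_ : Measurable h) (_ : ∀ x, f x ≤ (Metric.closedBall 0 R).indicator (fun _ => C) x)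
    (_ : ∀ x, g x ≤ (Metric.closedBall 0 R).indicator (fun _ => C) x)
    (_ : ∀ x y, f x ^ (1 - t) * g y ^ t ≤ h ((1 - t) • x + t • y)),
    (∫⁻ x, f x) ^ (1 - t) * (∫⁻ x, g x) ^ t ≤ ∫⁻ x, h x
  | 0, f, g, h, C, _, _, _, _, _, _, hfg => by
    rw [lintegral_unique, lintegral_unique, lintegral_unique]
    simp only [volume_pi, Measure.pi_univ, Finset.univ_eq_empty, Finset.prod_empty, mul_one]
    refine (hfg _ _).trans_eq ?_
    congr 1
    exact Subsingleton.elim _ _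
  | n + 1, f, g, h, C, hC, hf, hg, hh, hfC, hgC, hfg => by
    rw [lintegral_fin_succ hf, lintegral_fin_succ hg, lintegral_fin_succ hh]
    have sl : ∀ {u : (Fin (n + 1) → ℝ) → ℝ≥0∞},
        (∀ x, u x ≤ (Metric.closedBall 0 R).indicator (fun _ => C) x) → ∀ (x : ℝ) (z : Fin n → ℝ),
        u (Fin.cons x z) ≤ (Metric.closedBall 0 R).indicator (fun _ => C) z := by
      intro u hu x z
      by_cases hz : z ∈ Metric.closedBall (0 : Fin n → ℝ) R
      · rw [Set.indicator_of_mem hz]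
        exact (hu _).trans (Set.indicator_le_self _ _ _)
      · rw [Set.indicator_of_notMem hz]
        refine (hu _).trans ?_
        rw [Set.indicator_of_notMem]
        contrapose! hz
        rw [mem_closedBall_zero_iff] at hz ⊢
        refine le_trans ?_ hz
        refine (pi_norm_le_iff_of_nonneg (norm_nonneg _)).2 fun i => ?_
        simpa using norm_le_pi_norm (Fin.cons x z : Fin (n + 1) → ℝ) i.succ
    have bd : ∀ {u : (Fin (n + 1) → ℝ) → ℝ≥0∞},
        (∀ x, u x ≤ (Metric.closedBall 0 R).indicator (fun _ => C) x) → ∀ (x : ℝ),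
        ∫⁻ z : Fin n → ℝ, u (Fin.cons x z) ≤ C * volume (Metric.closedBall (0 : Fin n → ℝ) R) := by
      intro u hu x
      refine (lintegral_mono (sl hu x)).trans_eq ?_
      rw [lintegral_indicator_const Metric.isClosed_closedBall.measurableSet]
    refine prekopa_leindler_one h0 h1
      (ENNReal.mul_ne_top hC (measure_closedBall_lt_top (x := (0 : Fin n → ℝ)) (r := R)).ne)
      ?_ ?_ ?_ (bd hfC) (bd hgC) ?_
    · exact (hf.comp measurable_fin_cons).lintegral_prod_right'
    · exact (hg.comp measurable_fin_cons).lintegral_prod_right'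
    · exact (hh.comp measurable_fin_cons).lintegral_prod_right'
    · intro x y
      have mc : ∀ x : ℝ, Measurable fun z : Fin n → ℝ => (Fin.cons x z : Fin (n + 1) → ℝ) :=
        fun x => measurable_fin_cons.comp (measurable_const.prodMk measurable_id)
      refine prekopa_leindler h0 h1 R hC (hf.comp (mc x)) (hg.comp (mc y)) (hh.comp (mc _))
        (sl hfC x) (sl hgC y) fun z w => ?_
      refine (hfg _ _).trans_eq ?_
      congr 1
      ext i
      refine Fin.cases ?_ (fun j => ?_) i <;> simp

lemma volume_rpow_mul_le {n : ℕ} {t : ℝ} (h0 : 0 < t) (h1 : t < 1) {A B C : Set (Fin n → ℝ)}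
    (hA : MeasurableSet A) (hB : MeasurableSet B) (hC : MeasurableSet C)
    (hA' : Bornology.IsBounded A) (hB' : Bornology.IsBounded B)
    (h : ∀ x ∈ A, ∀ y ∈ B, (1 - t) • x + t • y ∈ C) :
    volume A ^ (1 - t) * volume B ^ t ≤ volume C := by
  have ht : 0 < 1 - t := by linarith
  obtain ⟨R, hR⟩ := (hA'.union hB').subset_closedBall 0
  rw [← lintegral_indicator_one hA, ← lintegral_indicator_one hB, ← lintegral_indicator_one hC]
  have sub : ∀ D : Set (Fin n → ℝ), D ⊆ Metric.closedBall 0 R → ∀ x,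
      D.indicator 1 x ≤ (Metric.closedBall 0 R).indicator (fun _ => (1 : ℝ≥0∞)) x :=
    fun D hD x => Set.indicator_le_indicator_of_subset hD (by simp) x
  refine prekopa_leindler h0 h1 R ENNReal.one_ne_top (measurable_one.indicator hA)
    (measurable_one.indicator hB) (measurable_one.indicator hC)
    (sub A (Set.subset_union_left.trans hR)) (sub B (Set.subset_union_right.trans hR)) ?_
  intro x y
  by_cases hx : x ∈ A
  · by_cases hy : y ∈ B
    · simp [hx, hy, h x hx y hy]
    · simp [hy, h0]
  · simp [hx, ht]

lemma concaveOn_log_volume_inter_closedBall {n : ℕ} {P : Set (Fin n → ℝ)} (hP : IsCompact P)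
    (hc : Convex ℝ P) (r : ℝ) :
    ConcaveOn ℝ {x | 0 < volume.real (P ∩ Metric.closedBall x r)}
      fun x => Real.log (volume.real (P ∩ Metric.closedBall x r)) := by
  have hcpt : ∀ x, IsCompact (P ∩ Metric.closedBall x r) := fun x =>
    hP.inter_right Metric.isClosed_closedBall
  have key : ∀ x y, ∀ t : ℝ, 0 < t → t < 1 → volume.real (P ∩ Metric.closedBall x r) ^ (1 - t) *
      volume.real (P ∩ Metric.closedBall y r) ^ t ≤
        volume.real (P ∩ Metric.closedBall ((1 - t) • x + t • y) r) := by
    intro x y t h0 h1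
    have hmem : ∀ u ∈ P ∩ Metric.closedBall x r, ∀ v ∈ P ∩ Metric.closedBall y r,
        (1 - t) • u + t • v ∈ P ∩ Metric.closedBall ((1 - t) • x + t • y) r := by
      rintro u ⟨hu, e1⟩ v ⟨hv, e2⟩
      have h2 : 0 ≤ 1 - t := by linarith
      refine ⟨convex_iff_add_mem.1 hc hu hv h2 h0.le (by ring), ?_⟩
      rw [mem_closedBall_iff_norm] at e1 e2 ⊢
      calc ‖(1 - t) • u + t • v - ((1 - t) • x + t • y)‖
          = ‖(1 - t) • (u - x) + t • (v - y)‖ := by congr 1; module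
        _ ≤ (1 - t) * r + t * r := by
            refine (norm_add_le _ _).trans ?_
            rw [norm_smul, norm_smul, Real.norm_of_nonneg h0.le, Real.norm_of_nonneg h2]
            gcongr
        _ = r := by ring
    have := volume_rpow_mul_le h0 h1 (hcpt x).measurableSet (hcpt y).measurableSet
      (hcpt ((1 - t) • x + t • y)).measurableSet (hcpt x).isBounded (hcpt y).isBounded hmem
    have := ENNReal.toReal_mono (hcpt _).measure_ne_top this
    rwa [ENNReal.toReal_mul, ← ENNReal.toReal_rpow, ← ENNReal.toReal_rpow] at this
  have pos : ∀ x ∈ {x | 0 < volume.real (P ∩ Metric.closedBall x r)},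
      ∀ y ∈ {x | 0 < volume.real (P ∩ Metric.closedBall x r)}, ∀ t : ℝ, 0 < t → t < 1 →
      0 < volume.real (P ∩ Metric.closedBall ((1 - t) • x + t • y) r) := by
    intro x hx y hy t h0 h1
    exact (mul_pos (Real.rpow_pos_of_pos hx _) (Real.rpow_pos_of_pos hy _)).trans_le
      (key x y t h0 h1)
  constructor
  · refine convex_iff_forall_pos.2 fun x hx y hy a b ha hb hab => ?_
    obtain rfl : a = 1 - b := by linarith
    exact pos x hx y hy b hb (by linarith)
  · intro x hx y hy a b ha hb hab
    rcases ha.eq_or_lt with rfl | ha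
    · obtain rfl : b = 1 := by linarith
      simp
    rcases hb.eq_or_lt with rfl | hb
    · obtain rfl : a = 1 := by linarith
      simp
    obtain rfl : a = 1 - b := by linarith
    have := Real.log_le_log (mul_pos (Real.rpow_pos_of_pos hx _) (Real.rpow_pos_of_pos hy _))
      (key x y b hb (by linarith))
    rw [Real.log_mul (Real.rpow_pos_of_pos hx _).ne' (Real.rpow_pos_of_pos hy _).ne',
      Real.log_rpow hx, Real.log_rpow hy] at this
    exact this

/-- If a convex body is cut into `#s` cells of diameter at most `r`, then the ball of radius `r`
around its barycenter carries at least the average share of the volume. -/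
lemma volume_le_card_mul_barycenter {n : ℕ} {ι : Type*} [DecidableEq ι] {P : Set (Fin n → ℝ)}
    (hP : IsCompact P) (hc : Convex ℝ P) (κ : (Fin n → ℝ) → ι) (s : Finset ι) {r : ℝ}
    (hm : ∀ i, MeasurableSet (κ ⁻¹' {i})) (hs : ∀ x ∈ P, κ x ∈ s)
    (hr : ∀ x ∈ P, ∀ y ∈ P, κ x = κ y → dist x y ≤ r) :
    volume.real P ≤ s.card * volume.real (P ∩ Metric.closedBall (⨍ x in P, x) r) := by
  rcases (measureReal_nonneg (μ := volume) (s := P)).eq_or_lt with h0 | hV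
  · rw [← h0]; positivity
  set A : ι → Set (Fin n → ℝ) := fun i => P ∩ κ ⁻¹' {i} with hA
  have hAm : ∀ i, MeasurableSet (A i) := fun i => hP.measurableSet.inter (hm i)
  have hAf : ∀ i, volume (A i) ≠ ∞ := fun i =>
    measure_ne_top_of_subset Set.inter_subset_left hP.measure_ne_top
  have hAd : Pairwise (Function.onFun Disjoint A) := by
    intro i j hij
    refine Set.disjoint_left.2 fun x hx hx' => hij ?_
    exact hx.2.symm.trans hx'.2
  have hPU : P = ⋃ i ∈ s, A i := by
    ext x
    simp only [hA, Set.mem_iUnion, Set.mem_inter_iff, Set.mem_preimage, Set.mem_singleton_iff,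
      exists_prop]
    exact ⟨fun h => ⟨_, hs x h, h, rfl⟩, fun ⟨_, _, h, _⟩ => h⟩
  have hP_int : IntegrableOn (fun x : Fin n → ℝ => x) P :=
    continuous_id.continuousOn.integrableOn_compact hP
  have hsum : ∑ i ∈ s, volume.real (A i) = volume.real P := by
    conv_rhs => rw [hPU]
    rw [measureReal_biUnion_finset (fun i _ j _ hij => hAd hij) (fun i _ => hAm i)
      (fun i _ => hAf i)]
  have hisum : ∑ i ∈ s, ∫ x in A i, x = ∫ x in P, x := by
    conv_rhs => rw [hPU]
    rw [integral_biUnion_finset s (fun i _ => hAm i) (fun i _ j _ hij => hAd hij)]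
    exact fun i _ => hP_int.mono_set Set.inter_subset_left
  set s' := s.filter fun i => 0 < volume.real (A i) with hs'
  have hz : ∀ i, i ∈ s → i ∉ s' → volume.real (A i) = 0 := by
    intro i hi hi'
    by_contra h
    exact hi' (Finset.mem_filter.2 ⟨hi, lt_of_le_of_ne measureReal_nonneg (Ne.symm h)⟩)
  have hsum' : ∑ i ∈ s', volume.real (A i) = volume.real P := by
    rw [← hsum]
    exact Finset.sum_subset (Finset.filter_subset _ _) hz
  have hisum' : ∑ i ∈ s', ∫ x in A i, x = ∫ x in P, x := by
    rw [← hisum]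
    refine Finset.sum_subset (Finset.filter_subset _ _) fun i hi hi' => ?_
    exact setIntegral_measure_zero _ (by simpa [measureReal_eq_zero_iff (hAf i)] using hz i hi hi')
  have hpos : ∀ i ∈ s', 0 < volume.real (A i) := fun i hi => (Finset.mem_filter.1 hi).2
  set V := volume.real P with hVd
  set w : ι → ℝ := fun i => volume.real (A i) / V with hw
  have hw0 : ∀ i ∈ s', 0 < w i := fun i hi => div_pos (hpos i hi) hV
  have hw1 : ∑ i ∈ s', w i = 1 := by
    rw [← Finset.sum_div, hsum', div_self hV.ne']
  have hbar : ⨍ x in P, x = ∑ i ∈ s', w i • ⨍ x in A i, x := by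
    rw [setAverage_eq, ← hisum', Finset.smul_sum]
    refine Finset.sum_congr rfl fun i hi => ?_
    rw [setAverage_eq, smul_smul]
    congr 1
    rw [hw, ← hVd]
    field_simp [(hpos i hi).ne']
  have hsub : ∀ i ∈ s', A i ⊆ P ∩ Metric.closedBall (⨍ x in A i, x) r := by
    intro i hi x hx
    refine ⟨hx.1, ?_⟩
    rw [Metric.mem_closedBall_comm]
    refine (convex_closedBall x r).set_average_mem Metric.isClosed_closedBall ?_ (hAf i) ?_
      (hP_int.mono_set Set.inter_subset_left)
    · intro h
      have := hpos i hi
      rw [measureReal_def, h] at this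
      simp at this
    · refine (ae_restrict_iff' (hAm i)).2 (Eventually.of_forall fun y hy => ?_)
      exact hr y hy.1 x hx.1 (hy.2.trans hx.2.symm)
  have hvol : ∀ i ∈ s', volume.real (A i) ≤
      volume.real (P ∩ Metric.closedBall (⨍ x in A i, x) r) := fun i hi =>
    measureReal_mono (hsub i hi)
      (measure_ne_top_of_subset Set.inter_subset_left hP.measure_ne_top)
  have hconc := concaveOn_log_volume_inter_closedBall hP hc r
  have hmem : ∀ i ∈ s', ⨍ x in A i, x ∈ {x | 0 < volume.real (P ∩ Metric.closedBall x r)} :=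
    fun i hi => (hpos i hi).trans_le (hvol i hi)
  have j1 := hconc.le_map_sum (fun i hi => (hw0 i hi).le) hw1 hmem
  have j2 := hconc.1.sum_mem (fun i hi => (hw0 i hi).le) hw1 hmem
  rw [← hbar] at j1 j2
  have j3 := strictConcaveOn_log_Ioi.concaveOn.le_map_sum (t := s') (w := w)
    (p := fun i => (w i)⁻¹) (fun i hi => (hw0 i hi).le) hw1 (fun i hi => inv_pos.2 (hw0 i hi))
  have hne : s'.Nonempty := by
    rw [Finset.nonempty_iff_ne_empty]
    rintro h
    rw [h] at hw1
    simp at hw1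
  have j4 : ∑ i ∈ s', w i • (w i)⁻¹ = s'.card := by
    rw [Finset.card_eq_sum_ones, Nat.cast_sum]
    refine Finset.sum_congr rfl fun i hi => ?_
    simp [(hw0 i hi).ne']
  rw [j4] at j3
  have hfin : Real.log (V / s'.card) ≤
      Real.log (volume.real (P ∩ Metric.closedBall (⨍ x in P, x) r)) := by
    refine le_trans ?_ j1
    rw [Real.log_div hV.ne' (by exact_mod_cast hne.card_pos.ne')]
    refine (sub_le_sub_left j3 _).trans ?_
    rw [← one_mul (Real.log V), ← hw1, Finset.sum_mul, ← Finset.sum_sub_distrib]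
    refine Finset.sum_le_sum fun i hi => ?_
    rw [Real.log_inv, smul_eq_mul, smul_eq_mul, mul_neg, sub_neg_eq_add, ← mul_add,
      ← Real.log_mul hV.ne' (hw0 i hi).ne']
    refine mul_le_mul_of_nonneg_left (Real.log_le_log (mul_pos hV (hw0 i hi)) ?_) (hw0 i hi).le
    refine le_trans (le_of_eq ?_) (hvol i hi)
    rw [hw]
    field_simp
  have hcp : (0 : ℝ) < s'.card := by exact_mod_cast hne.card_pos
  have hle := (Real.log_le_log_iff (div_pos hV hcp) j2).1 hfin
  rw [div_le_iff₀ hcp] at hle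
  refine hle.trans ?_
  rw [mul_comm]
  refine mul_le_mul_of_nonneg_right ?_ measureReal_nonneg
  exact_mod_cast Finset.card_filter_le _ _

lemma convex_combination_eq {a b z : ℝ} (ha : a ≤ z) (hb : z ≤ b) :
    ∃ s t : ℝ, 0 ≤ s ∧ 0 ≤ t ∧ s + t = 1 ∧ s * a + t * b = z := by
  have : z ∈ segment ℝ a b := by rw [segment_eq_Icc (ha.trans hb)]; exact ⟨ha, hb⟩
  obtain ⟨s, t, hs, ht, h1, h2⟩ := this
  exact ⟨s, t, hs, ht, h1, by simpa using h2⟩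

/-- A convex set meeting all the orthants spanned by a box contains the box. -/
lemma Convex.Icc_subset_of_orthants {ι : Type*} [Fintype ι] [DecidableEq ι] {P : Set (ι → ℝ)}
    (hP : Convex ℝ P) {l u : ι → ℝ}
    (h : ∀ A : Finset ι, ∃ x ∈ P, ∀ i, (i ∈ A → u i ≤ x i) ∧ (i ∉ A → x i ≤ l i)) :
    Set.Icc l u ⊆ P := by
  rintro z ⟨hlz, hzu⟩
  have key : ∀ S : Finset ι, ∀ A : Finset ι, ∃ x ∈ P, (∀ i ∈ S, x i = z i) ∧
      ∀ i ∉ S, (i ∈ A → u i ≤ x i) ∧ (i ∉ A → x i ≤ l i) := by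
    intro S
    induction S using Finset.induction_on with
    | empty =>
      intro A
      obtain ⟨x, hx, hx'⟩ := h A
      exact ⟨x, hx, by simp, fun i _ => hx' i⟩
    | insert j S hj ih =>
      intro A
      obtain ⟨x, hx, hxS, hxA⟩ := ih (insert j A)
      obtain ⟨y, hy, hyS, hyA⟩ := ih (A.erase j)
      have h1 : z j ≤ x j := (hzu j).trans ((hxA j hj).1 (Finset.mem_insert_self _ _))
      have h2 : y j ≤ z j := ((hyA j hj).2 (Finset.notMem_erase _ _)).trans (hlz j)
      obtain ⟨s, t, hs, ht, hst, he⟩ := convex_combination_eq h2 h1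
      refine ⟨s • y + t • x, convex_iff_add_mem.1 hP hy hx hs ht hst, ?_, ?_⟩
      · intro i hi
        rcases Finset.mem_insert.1 hi with rfl | hi
        · simpa using he
        · simp only [Pi.add_apply, Pi.smul_apply, smul_eq_mul, hxS i hi, hyS i hi, ← add_mul, hst,
            one_mul]
      · intro i hi
        rw [Finset.mem_insert, not_or] at hi
        have e1 := hxA i hi.2
        have e2 := hyA i hi.2
        simp only [Finset.mem_insert, hi.1, false_or, Finset.mem_erase, ne_eq, not_false_eq_true,
          true_and] at e1 e2
        simp only [Pi.add_apply, Pi.smul_apply, smul_eq_mul]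
        constructor
        · intro hA
          have f1 := mul_le_mul_of_nonneg_left (e1.1 hA) ht
          have f2 := mul_le_mul_of_nonneg_left (e2.1 hA) hs
          calc u i = s * u i + t * u i := by rw [← add_mul, hst, one_mul]
            _ ≤ _ := by linarith
        · intro hA
          have f1 := mul_le_mul_of_nonneg_left (e1.2 hA) ht
          have f2 := mul_le_mul_of_nonneg_left (e2.2 hA) hs
          calc _ ≤ s * l i + t * l i := by linarith
            _ = l i := by rw [← add_mul, hst, one_mul]
  obtain ⟨x, hx, hxz, -⟩ := key Finset.univ ∅
  rwa [← show x = z from funext fun i => hxz i (Finset.mem_univ i)]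

/-- The index of the grid cell of side `1 / p` containing a point of the nonnegative orthant. -/
noncomputable def gridCode {n : ℕ} (p : ℕ) (x : Fin n → ℝ) : Fin n → ℕ := fun i => ⌊p * x i⌋₊

/-- The coordinate projection along a choice of coordinates. -/
def coordProj {n s : ℕ} (J : Fin s → Fin n) (x : Fin n → ℝ) : Fin s → ℝ := fun k => x (J k)

lemma Convex.coordProj {n s : ℕ} (J : Fin s → Fin n) {P : Set (Fin n → ℝ)} (hP : Convex ℝ P) :
    Convex ℝ (coordProj J '' P) :=
  hP.is_linear_image (f := _root_.coordProj J) ⟨fun _ _ => rfl, fun _ _ => rfl⟩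

lemma card_sparse_le (n m p : ℕ) (hp : 0 < p) (𝒯 : Finset (Finset (Fin n × ℕ)))
    (h1 : ∀ T ∈ 𝒯, T.card ≤ m) (h2 : ∀ T ∈ 𝒯, ∀ q ∈ T, q.2 < p)
    (h3 : ∀ T ∈ 𝒯, ∀ q ∈ T, ∀ q' ∈ T, q.1 = q'.1 → q = q') : 𝒯.card ≤ 2 ^ n * p ^ m := by
  classical
  set 𝒰 := (Finset.univ.filter fun I : Finset (Fin n) => I.card ≤ m).biUnion fun I =>
    (Fintype.piFinset fun i : Fin n => if i ∈ I then Finset.range p else {0}).image fun g =>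
      I.image fun i => (i, g i) with h𝒰
  have hsub : 𝒯 ⊆ 𝒰 := by
    intro T hT
    simp only [h𝒰, Finset.mem_biUnion, Finset.mem_filter, Finset.mem_univ, true_and,
      Finset.mem_image, Fintype.mem_piFinset]
    have hg : ∀ i, ∃ a, ((i ∈ T.image Prod.fst) → (i, a) ∈ T) ∧ (i ∉ T.image Prod.fst → a = 0) := by
      intro i
      by_cases hi : i ∈ T.image Prod.fst
      · obtain ⟨q, hq, rfl⟩ := Finset.mem_image.1 hi
        exact ⟨q.2, fun _ => hq, fun h => absurd hi h⟩
      · exact ⟨0, fun h => absurd h hi, fun _ => rfl⟩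
    choose g hg1 hg2 using hg
    refine ⟨T.image Prod.fst, Finset.card_image_le.trans (h1 T hT), g, fun i => ?_, ?_⟩
    · split_ifs with hi
      · exact Finset.mem_range.2 (h2 T hT _ (hg1 i hi))
      · exact Finset.mem_singleton.2 (hg2 i hi)
    · ext q
      simp only [Finset.mem_image]
      constructor
      · rintro ⟨i, ⟨q', hq', rfl⟩, rfl⟩
        exact hg1 _ (Finset.mem_image_of_mem _ hq')
      · intro hq
        exact ⟨q.1, ⟨q, hq, rfl⟩, h3 T hT _ (hg1 _ (Finset.mem_image_of_mem _ hq)) _ hq rfl⟩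
  refine (Finset.card_le_card hsub).trans (Finset.card_biUnion_le.trans ?_)
  have : ∀ I ∈ (Finset.univ.filter fun I : Finset (Fin n) => I.card ≤ m),
      ((Fintype.piFinset fun i : Fin n => if i ∈ I then Finset.range p else {0}).image fun g =>
      I.image fun i => (i, g i)).card ≤ p ^ m := by
    intro I hI
    refine Finset.card_image_le.trans ?_
    rw [Fintype.card_piFinset]
    have : ∀ i, (if i ∈ I then Finset.range p else {0}).card = if i ∈ I then p else 1 := by
      intro i; split_ifs <;> simp
    simp only [this, Finset.prod_ite_mem, Finset.univ_inter, Finset.prod_const]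
    exact Nat.pow_le_pow_right hp (Finset.mem_filter.1 hI).2
  refine (Finset.sum_le_card_nsmul _ _ _ this).trans ?_
  rw [smul_eq_mul]
  refine Nat.mul_le_mul_right _ ((Finset.card_filter_le _ _).trans_eq ?_)
  simp

/-- A convex subset of the cube none of whose projections to `m + 1` coordinates has volume at
least that of a grid cell meets few grid cells. -/
lemma card_gridCode_le {n m p : ℕ} (hp : 0 < p) {P : Set (Fin n → ℝ)} (hc : Convex ℝ P)
    (hP : P ⊆ Set.Icc 0 1)
    (hJ : ∀ J : Fin (m + 1) → Fin n, Function.Injective J →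
      volume (coordProj J '' P) < ENNReal.ofReal ((1 / p : ℝ) ^ (m + 1)))
    (𝒞 : Finset (Fin n → ℕ)) (h𝒞 : ∀ C ∈ 𝒞, ∃ x ∈ P, gridCode p x = C) :
    𝒞.card ≤ 4 ^ n * p ^ m := by
  classical
  have hp' : (0 : ℝ) < p := by exact_mod_cast hp
  set sub : (Fin n → ℕ) → Finset (Fin n × ℕ) := fun C =>
    (Finset.univ ×ˢ Finset.range p).filter fun q => q.2 < C q.1 with hsub
  have hle : ∀ C ∈ 𝒞, ∀ i, C i ≤ p := by
    intro C hC i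
    obtain ⟨x, hx, rfl⟩ := h𝒞 C hC
    refine Nat.floor_le_of_le ?_
    have := (hP hx).2 i
    simp only [Pi.one_apply] at this
    nlinarith
  have hmem : ∀ C ∈ 𝒞, ∀ q, q ∈ sub C ↔ q.2 < C q.1 := by
    intro C hC q
    simp only [hsub, Finset.mem_filter, Finset.mem_product, Finset.mem_univ, true_and,
      Finset.mem_range, and_iff_right_iff_imp]
    exact fun h => h.trans_le (hle C hC _)
  have hinj : Set.InjOn sub 𝒞 := by
    intro C hC C' hC' he
    ext i
    refine eq_of_forall_lt_iff fun a => ?_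
    have e1 := hmem C hC (i, a)
    have e2 := hmem C' hC' (i, a)
    rw [he] at e1
    exact e1.symm.trans e2
  have hcls : ∀ e : Fin n → Bool,
      (𝒞.filter fun C => (fun i => (C i).bodd) = e).card ≤ 2 ^ n * p ^ m := by
    intro e
    set 𝒟 := 𝒞.filter fun C => (fun i => (C i).bodd) = e with h𝒟
    have hD : ∀ C ∈ 𝒟, C ∈ 𝒞 := fun C hC => (Finset.mem_filter.1 hC).1
    have hDe : ∀ C ∈ 𝒟, ∀ i, (C i).bodd = e i := fun C hC i =>
      congrFun (Finset.mem_filter.1 hC).2 i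
    have hcard : 𝒟.card = (𝒟.image sub).card :=
      (Finset.card_image_of_injOn (hinj.mono fun C hC => hD C hC)).symm
    rw [hcard]
    refine (Finset.card_le_card_shatterer _).trans ?_
    have hsh : ∀ T ∈ (𝒟.image sub).shatterer, ∀ t ⊆ T, ∃ C ∈ 𝒟, ∀ q ∈ T, q ∈ t ↔ q.2 < C q.1 := by
      intro T hT t ht
      obtain ⟨u, hu, hut⟩ := (Finset.mem_shatterer.1 hT) ht
      obtain ⟨C, hC, rfl⟩ := Finset.mem_image.1 hu
      refine ⟨C, hC, fun q hq => ?_⟩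
      rw [← hmem C (hD C hC), ← hut, Finset.mem_inter]
      exact and_iff_right hq
    have hfst : ∀ T ∈ (𝒟.image sub).shatterer, ∀ q ∈ T, ∀ q' ∈ T, q.1 = q'.1 → q.2 ≤ q'.2 := by
      intro T hT q hq q' hq' h
      by_contra! hlt
      obtain ⟨C, hC, hCT⟩ := hsh T hT {q} (by simpa using hq)
      have e1 := (hCT q hq).1 (by simp)
      have e2 := (hCT q' hq').2 (by rw [← h]; omega)
      rw [Finset.mem_singleton] at e2
      rw [e2] at hlt
      exact lt_irrefl _ hlt
    refine card_sparse_le n m p hp _ ?_ ?_ ?_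
    · intro T hT
      by_contra! hcT
      obtain ⟨T', hT'T, hT'c⟩ := Finset.exists_subset_card_eq (Nat.succ_le_of_lt hcT)
      have hsh' := hsh T' (Finset.mem_shatterer.2
        (Finset.Shatters.mono_right hT'T (Finset.mem_shatterer.1 hT)))
      set eq := (Finset.equivFinOfCardEq hT'c).symm with heq
      set J : Fin (m + 1) → Fin n := fun k => (eq k).1.1 with hJd
      have hJi : Function.Injective J := by
        intro k k' hk
        refine eq.injective (Subtype.ext (Prod.ext hk (le_antisymm ?_ ?_)))
        · exact hfst T hT _ (hT'T (eq k).2) _ (hT'T (eq k').2) hk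
        · exact hfst T hT _ (hT'T (eq k').2) _ (hT'T (eq k).2) hk.symm
      refine absurd (hJ J hJi) (not_lt.2 ?_)
      set l : Fin (m + 1) → ℕ := fun k =>
        if ((eq k).1.2).bodd = e (J k) then (eq k).1.2 + 1 else (eq k).1.2 with hl
      have hbox : Set.Icc (fun k => (l k : ℝ) / p) (fun k => ((l k : ℝ) + 1) / p) ⊆
          coordProj J '' P := by
        refine (hc.coordProj J).Icc_subset_of_orthants fun A => ?_
        obtain ⟨C, hC, hCT⟩ := hsh' (A.image fun k => (eq k).1) (by
          intro q hq
          obtain ⟨k, -, rfl⟩ := Finset.mem_image.1 hq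
          exact (eq k).2)
        obtain ⟨x, hx, hxC⟩ := h𝒞 C (hD C hC)
        refine ⟨_, ⟨x, hx, rfl⟩, fun k => ?_⟩
        have hk : k ∈ A ↔ (eq k).1.2 < C (J k) := by
          rw [← hCT _ (eq k).2, Finset.mem_image]
          constructor
          · exact fun h => ⟨k, h, rfl⟩
          · rintro ⟨k', hk', he⟩
            rwa [← eq.injective (Subtype.ext he)]
        have hx0 : 0 ≤ x (J k) := (hP hx).1 (J k)
        have hf1 : ((C (J k) : ℕ) : ℝ) ≤ p * x (J k) := by
          rw [← hxC]; exact Nat.floor_le (by positivity)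
        have hf2 : p * x (J k) < (C (J k) : ℕ) + 1 := by
          rw [← hxC]; exact Nat.lt_floor_add_one _
        have hpar := hDe C hC (J k)
        constructor
        · intro hkA
          have h1 := hk.1 hkA
          have h2 : l k + 1 ≤ C (J k) := by
            simp only [hl]
            split_ifs with hb
            · rcases Nat.lt_or_ge ((eq k).1.2 + 1) (C (J k)) with h | h
              · omega
              · have h3 : C (J k) = (eq k).1.2 + 1 := by omega
                rw [h3, Nat.bodd_succ, ← hb] at hpar
                simp at hpar
            · omega
          have h3 : ((l k : ℝ) + 1) ≤ C (J k) := by exact_mod_cast h2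
          change _ ≤ x (J k)
          rw [div_le_iff₀ hp']
          linarith
        · intro hkA
          have h1 := mt hk.2 hkA
          have h2 : C (J k) + 1 ≤ l k := by
            simp only [hl]
            split_ifs with hb
            · omega
            · rcases Nat.lt_or_ge (C (J k)) ((eq k).1.2) with h | h
              · omega
              · have h3 : C (J k) = (eq k).1.2 := by omega
                rw [h3] at hpar
                exact absurd hpar hb
          have h3 : (C (J k) : ℝ) + 1 ≤ l k := by exact_mod_cast h2
          change x (J k) ≤ _
          rw [le_div_iff₀ hp']
          linarith
      refine le_trans (le_of_eq ?_) (measure_mono hbox)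
      rw [Real.volume_Icc_pi]
      have : ∀ k, ((l k : ℝ) + 1) / p - (l k : ℝ) / p = 1 / p := fun k => by ring
      simp only [this, Finset.prod_const, Finset.card_univ, Fintype.card_fin]
      rw [ENNReal.ofReal_pow (by positivity)]
    · intro T hT q hq
      obtain ⟨C, hC, hCT⟩ := hsh T hT {q} (by simpa using hq)
      exact ((hCT q hq).1 (by simp)).trans_le (hle C (hD C hC) _)
    · intro T hT q hq q' hq' h
      exact Prod.ext h (le_antisymm (hfst T hT q hq q' hq' h) (hfst T hT q' hq' q hq h.symm))
  rw [Finset.card_eq_sum_card_fiberwise (f := fun C i => (C i).bodd)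
    (t := (Finset.univ : Finset (Fin n → Bool))) (fun _ _ => by simp)]
  refine (Finset.sum_le_card_nsmul _ _ _ fun e _ => hcls e).trans_eq ?_
  rw [Finset.card_univ, Fintype.card_fun, Fintype.card_bool, Fintype.card_fin, smul_eq_mul,
    ← mul_assoc, ← mul_pow]
  norm_num

/-- Words of length `h` over the alphabet `Bool`, the leaves of the binary tree of height `h`. -/
def leaves : ℕ → Finset (List Bool)
  | 0 => {[]}
  | h + 1 => (leaves h).image (List.cons true) ∪ (leaves h).image (List.cons false)

lemma mem_leaves : ∀ {h : ℕ} {l : List Bool}, l ∈ leaves h ↔ l.length = h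
  | 0, l => by simp [leaves, List.length_eq_zero_iff]
  | h + 1, [] => by simp [leaves]
  | h + 1, b :: l => by
    have := mem_leaves (h := h) (l := l)
    cases b <;> simp [leaves, this]

lemma sum_leaves_succ {M : Type*} [AddCommMonoid M] (h : ℕ) (F : List Bool → M) :
    ∑ l ∈ leaves (h + 1), F l =
      ∑ l ∈ leaves h, F (true :: l) + ∑ l ∈ leaves h, F (false :: l) := by
  rw [leaves, Finset.sum_union, Finset.sum_image, Finset.sum_image]
  · intro a _ b _ hab; exact (List.cons.inj hab).2
  · intro a _ b _ hab; exact (List.cons.inj hab).2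
  · rw [Finset.disjoint_left]
    intro a ha hb
    obtain ⟨l, -, rfl⟩ := Finset.mem_image.1 ha
    obtain ⟨l', -, h'⟩ := Finset.mem_image.1 hb
    simp at h'

lemma card_leaves : ∀ h : ℕ, (leaves h).card = 2 ^ h
  | 0 => by simp [leaves]
  | h + 1 => by
    rw [Finset.card_eq_sum_ones, sum_leaves_succ, ← Finset.card_eq_sum_ones, card_leaves h]
    ring

/-- Exchange of the two branches at the node `ν`. -/
def flipAt : List Bool → List Bool → List Bool
  | _, [] => []
  | [], b :: l => (!b) :: l
  | c :: ν, b :: l => if b = c then b :: flipAt ν l else b :: l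

lemma length_flipAt : ∀ ν l : List Bool, (flipAt ν l).length = l.length
  | [], [] => by simp [flipAt]
  | _ :: _, [] => by simp [flipAt]
  | [], b :: l => by simp [flipAt]
  | c :: ν, b :: l => by
    have := length_flipAt ν l
    by_cases h : b = c <;> simp [flipAt, h, this]

lemma flipAt_flipAt : ∀ ν l : List Bool, flipAt ν (flipAt ν l) = l
  | [], [] => by simp [flipAt]
  | _ :: _, [] => by simp [flipAt]
  | [], b :: l => by simp [flipAt]
  | c :: ν, b :: l => by
    have := flipAt_flipAt ν l
    by_cases h : b = c <;> simp [flipAt, h, this]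

lemma flipAt_of_length_le : ∀ {ν l : List Bool}, l.length ≤ ν.length → flipAt ν l = l
  | [], [], _ => by simp [flipAt]
  | _ :: _, [], _ => by simp [flipAt]
  | [], b :: l, h => by simp at h
  | c :: ν, b :: l, h => by
    have := flipAt_of_length_le (ν := ν) (l := l) (by simpa using h)
    by_cases h : b = c <;> simp [flipAt, h, this]

def boolSign (b : Bool) : ℝ := if b then 1 else -1

lemma boolSign_not (b : Bool) : boolSign (!b) = -boolSign b := by
  cases b <;> simp [boolSign]

/-- The sign of the branch at the node `μ` which contains the leaf `l`, zero if `l` is not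
below `μ`. -/
def branchSign : List Bool → List Bool → ℝ
  | _, [] => 0
  | [], b :: _ => boolSign b
  | c :: μ, b :: l => if b = c then branchSign μ l else 0

lemma branchSign_flipAt_self : ∀ ν l : List Bool, branchSign ν (flipAt ν l) = -branchSign ν l
  | [], [] => by simp [flipAt, branchSign]
  | _ :: _, [] => by simp [flipAt, branchSign]
  | [], b :: l => by simp [flipAt, branchSign, boolSign_not]
  | c :: ν, b :: l => by
    have := branchSign_flipAt_self ν l
    by_cases h : b = c <;> simp [flipAt, branchSign, h, this]

lemma branchSign_flipAt : ∀ {μ ν : List Bool}, μ ≠ ν → ∀ l : List Bool,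
    branchSign μ (flipAt ν l) = branchSign (flipAt ν μ) l
  | [], [], h, _ => absurd rfl h
  | [], c :: ν, _, [] => by simp [flipAt, branchSign]
  | [], c :: ν, _, b :: l => by by_cases h : b = c <;> simp [flipAt, branchSign, h]
  | d :: μ, [], _, [] => by simp [flipAt, branchSign]
  | d :: μ, [], _, b :: l => by cases b <;> cases d <;> simp [flipAt, branchSign]
  | d :: μ, c :: ν, _, [] => by by_cases h : d = c <;> simp [flipAt, branchSign, h]
  | d :: μ, c :: ν, h, b :: l => by
    by_cases hd : d = c
    · subst hd
      have := branchSign_flipAt (μ := μ) (ν := ν) (by rintro rfl; exact h rfl) l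
      by_cases hb : b = d <;> simp [flipAt, branchSign, hb, this]
    · by_cases hb : b = c
      · subst hb
        simp [flipAt, branchSign, hd, Ne.symm hd]
      · simp [flipAt, branchSign, hd, hb]

/-- If every node is balanced, then the leaf weights are all equal. -/
lemma eq_of_balanced : ∀ {h : ℕ} {G : List Bool → ℝ}
    (_ : ∀ μ : List Bool, μ.length < h → ∑ l ∈ leaves h, branchSign μ l * G l = 0)
    {l l' : List Bool} (_ : l ∈ leaves h) (_ : l' ∈ leaves h), G l = G l'
  | 0, G, _, l, l', hl, hl' => by
    rw [leaves, Finset.mem_singleton] at hl hl'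
    rw [hl, hl']
  | h + 1, G, hG, l, l', hl, hl' => by
    have hb : ∀ b : Bool, ∀ k ∈ leaves h, ∀ k' ∈ leaves h, G (b :: k) = G (b :: k') := by
      intro b k hk k' hk'
      refine eq_of_balanced (h := h) (G := fun k => G (b :: k)) (fun μ hμ => ?_) hk hk'
      have := hG (b :: μ) (by simpa using hμ)
      rw [sum_leaves_succ] at this
      cases b <;> simpa [branchSign] using this
    have h0 := hG [] (by simp)
    rw [sum_leaves_succ] at h0
    have hne : List.replicate h true ∈ leaves h := mem_leaves.2 (by simp)
    set k₀ := List.replicate h true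
    have e : ∀ b : Bool, ∑ k ∈ leaves h, branchSign [] (b :: k) * G (b :: k) =
        2 ^ h * (boolSign b * G (b :: k₀)) := by
      intro b
      rw [Finset.sum_congr rfl fun k hk => by rw [hb b k hk k₀ hne, branchSign]]
      rw [Finset.sum_const, card_leaves]
      simp
    rw [e, e] at h0
    have h2 : (2 : ℝ) ^ h ≠ 0 := by positivity
    have h1 : G (true :: k₀) = G (false :: k₀) := by
      have : (2 : ℝ) ^ h * (G (true :: k₀) - G (false :: k₀)) = 0 := by
        rw [← h0]; simp [boolSign]; ring
      have := (mul_eq_zero.1 this).resolve_left h2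
      linarith
    have all : ∀ b : Bool, ∀ k ∈ leaves h, G (b :: k) = G (true :: k₀) := by
      intro b k hk
      rw [hb b k hk k₀ hne]
      cases b
      · exact h1.symm
      · rfl
    have fin : ∀ l ∈ leaves (h + 1), G l = G (true :: k₀) := by
      intro l hl
      cases l with
      | nil => simp [mem_leaves] at hl
      | cons b k => exact all b k (mem_leaves.2 (by simpa [mem_leaves] using hl))
    rw [fin l hl, fin l' hl']

/-- An enumeration of binary words which is monotone in the length. -/
def wordRank : List Bool → ℕ
  | [] => 1
  | b :: l => 2 * wordRank l + b.toNat

lemma wordRank_bounds : ∀ l : List Bool, 2 ^ l.length ≤ wordRank l ∧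
    wordRank l < 2 ^ (l.length + 1)
  | [] => by simp [wordRank]
  | b :: l => by
    have := wordRank_bounds l
    have hb := Bool.toNat_le b
    simp only [wordRank, List.length_cons, pow_succ] at this ⊢
    omega

lemma wordRank_injective : Function.Injective wordRank := by
  intro l
  induction l with
  | nil =>
    intro l' h
    cases l' with
    | nil => rfl
    | cons b l' =>
      have := (wordRank_bounds l').1
      have h2 : 0 < 2 ^ l'.length := by positivity
      simp only [wordRank] at h
      omega
  | cons b l ih =>
    intro l' h
    cases l' with
    | nil =>
      have := (wordRank_bounds l).1
      have h2 : 0 < 2 ^ l.length := by positivity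
      simp only [wordRank] at h
      omega
    | cons b' l' =>
      simp only [wordRank] at h
      have h1 := Bool.toNat_le b
      have h2 := Bool.toNat_le b'
      have h3 : b.toNat = b'.toNat := by omega
      rw [ih (show wordRank l = wordRank l' by omega)]
      cases b <;> cases b' <;> simp_all

lemma length_le_of_wordRank_le {l l' : List Bool} (h : wordRank l ≤ wordRank l') :
    l.length ≤ l'.length := by
  by_contra! hlt
  have h1 := (wordRank_bounds l).1
  have h2 := (wordRank_bounds l').2
  have h3 : 2 ^ (l'.length + 1) ≤ 2 ^ l.length := Nat.pow_le_pow_right (by norm_num) hlt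
  omega

/-- The affine function with parameter `t` on the coordinates `J`; it is odd in `t` on the unit
sphere and never identically zero. -/
noncomputable def cut {n s : ℕ} (J : Fin s → Fin n) (t : Fin s → ℝ) (z : Fin n → ℝ) : ℝ :=
  ∑ i, t i * z (J i) + (1 - ‖t‖)

lemma continuous_cut {n s : ℕ} (J : Fin s → Fin n) :
    Continuous fun q : (Fin s → ℝ) × (Fin n → ℝ) => cut J q.1 q.2 := by
  unfold cut
  fun_prop

lemma cut_neg {n s : ℕ} (J : Fin s → Fin n) {t : Fin s → ℝ} (ht : ‖t‖ = 1) (z : Fin n → ℝ) :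
    cut J (-t) z = -cut J t z := by
  simp [cut, ht]

lemma volume_cut_eq_zero {n s : ℕ} {J : Fin s → Fin n} (hJ : Function.Injective J)
    (t : Fin s → ℝ) : volume {z : Fin n → ℝ | cut J t z = 0} = 0 := by
  classical
  by_cases ht : t = 0
  · subst ht
    simp [cut]
  obtain ⟨k, hk⟩ : ∃ k, t k ≠ 0 := by
    by_contra! h
    exact ht (funext h)
  let φ : (Fin n → ℝ) →ₗ[ℝ] ℝ := ∑ i, t i • LinearMap.proj (J i)
  have hφ : ∀ z, φ z = ∑ i, t i * z (J i) := fun z => by simp [φ]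
  have hφk : φ (Pi.single (J k) 1) = t k := by
    rw [hφ, Finset.sum_eq_single k]
    · simp
    · intro i _ hi
      rw [Pi.single_eq_of_ne (hJ.ne hi)]
      simp
    · simp
  rcases Set.eq_empty_or_nonempty {z : Fin n → ℝ | cut J t z = 0} with h | ⟨w, hw⟩
  · rw [h]; simp
  have hsub : {z : Fin n → ℝ | cut J t z = 0} = (fun z => -w + z) ⁻¹' (LinearMap.ker φ : Set (Fin n → ℝ)) := by
    ext z
    have hw' : cut J t w = 0 := hw
    simp only [cut, ← hφ] at hw'
    simp only [Set.mem_ofPred_eq, cut, ← hφ, Set.mem_preimage, SetLike.mem_coe, LinearMap.mem_ker,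
      map_add, map_neg]
    constructor <;> intro h <;> linarith
  rw [hsub, measure_preimage_add]
  refine Measure.addHaar_submodule _ _ fun h => hk ?_
  rw [← hφk, ← LinearMap.mem_ker, h]
  trivial

/-- The half-space on the `b` side of a cut. -/
def halfSpace {n s : ℕ} (J : Fin s → Fin n) (t : Fin s → ℝ) (b : Bool) : Set (Fin n → ℝ) :=
  {z | 0 ≤ boolSign b * cut J t z}

lemma isClosed_halfSpace {n s : ℕ} (J : Fin s → Fin n) (t : Fin s → ℝ) (b : Bool) :
    IsClosed (halfSpace J t b) := by
  have : Continuous fun z => cut J t z :=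
    (continuous_cut J).comp (continuous_const.prodMk continuous_id)
  exact isClosed_le continuous_const (continuous_const.mul this)

lemma convex_halfSpace {n s : ℕ} (J : Fin s → Fin n) (t : Fin s → ℝ) (b : Bool) :
    Convex ℝ (halfSpace J t b) := by
  rw [convex_iff_add_mem]
  intro x hx y hy α β hα hβ hαβ
  have : cut J t (α • x + β • y) = α * cut J t x + β * cut J t y := by
    simp only [cut, Pi.add_apply, Pi.smul_apply, smul_eq_mul, mul_add, Finset.sum_add_distrib,
      Finset.mul_sum]
    rw [Finset.sum_congr rfl fun i _ => mul_left_comm (t i) α _,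
      Finset.sum_congr rfl fun i _ => mul_left_comm (t i) β _]
    linear_combination (-(1 - ‖t‖)) * hαβ
  simp only [halfSpace, Set.mem_ofPred_eq] at hx hy ⊢
  rw [this, mul_add, mul_left_comm, mul_left_comm _ β]
  positivity

lemma halfSpace_union {n s : ℕ} (J : Fin s → Fin n) (t : Fin s → ℝ) :
    halfSpace J t true ∪ halfSpace J t false = Set.univ := by
  ext z
  simp only [halfSpace, boolSign, Set.mem_union, Set.mem_ofPred_eq, Set.mem_univ, iff_true]
  rcases le_total 0 (cut J t z) with h | h
  · left; simpa using h
  · right; simpa using h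

lemma halfSpace_inter {n s : ℕ} (J : Fin s → Fin n) (t : Fin s → ℝ) :
    halfSpace J t true ∩ halfSpace J t false ⊆ {z | cut J t z = 0} := by
  rintro z ⟨h1, h2⟩
  simp only [halfSpace, boolSign, Set.mem_ofPred_eq] at h1 h2
  norm_num at h1 h2
  exact le_antisymm h2 h1

/-- The region obtained by following the path `l` through the tree of cuts with parameters `x`,
where the cuts at depth `k` involve the coordinates `J k`. -/
def region {n s : ℕ} : (ℕ → Fin s → Fin n) → (List Bool → Fin s → ℝ) → List Bool →
    Set (Fin n → ℝ)
  | _, _, [] => Set.univ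
  | J, x, b :: l => halfSpace (J 0) (x []) b ∩
      region (fun k => J (k + 1)) (fun μ => x (b :: μ)) l

lemma isClosed_region {n s : ℕ} : ∀ (J : ℕ → Fin s → Fin n) (x : List Bool → Fin s → ℝ)
    (l : List Bool), IsClosed (region J x l)
  | _, _, [] => isClosed_univ
  | _, _, _ :: _ => (isClosed_halfSpace _ _ _).inter (isClosed_region _ _ _)

lemma convex_region {n s : ℕ} : ∀ (J : ℕ → Fin s → Fin n) (x : List Bool → Fin s → ℝ)
    (l : List Bool), Convex ℝ (region J x l)
  | _, _, [] => convex_univ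
  | _, _, _ :: _ => (convex_halfSpace _ _ _).inter (convex_region _ _ _)

lemma exists_mem_region {n s : ℕ} (z : Fin n → ℝ) : ∀ (h : ℕ) (J : ℕ → Fin s → Fin n)
    (x : List Bool → Fin s → ℝ), ∃ l ∈ leaves h, z ∈ region J x l
  | 0, _, _ => ⟨[], by simp [leaves], trivial⟩
  | h + 1, J, x => by
    have : ∃ b, z ∈ halfSpace (J 0) (x []) b := by
      rcases (halfSpace_union (J 0) (x [])).ge (Set.mem_univ z) with h | h
      exacts [⟨_, h⟩, ⟨_, h⟩]
    obtain ⟨b, hb⟩ := this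
    obtain ⟨l, hl, hz⟩ := exists_mem_region z h (fun k => J (k + 1)) (fun μ => x (b :: μ))
    exact ⟨b :: l, mem_leaves.2 (by simpa [mem_leaves] using hl), hb, hz⟩

lemma volume_region_inter {n s : ℕ} : ∀ {J : ℕ → Fin s → Fin n} (_ : ∀ k, Function.Injective (J k))
    (x : List Bool → Fin s → ℝ) {l l' : List Bool} (_ : l.length = l'.length) (_ : l ≠ l'),
    volume (region J x l ∩ region J x l') = 0
  | _, _, _, [], [], _, h => absurd rfl h
  | _, _, _, [], _ :: _, h, _ => by simp at h
  | _, _, _, _ :: _, [], h, _ => by simp at h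
  | J, hJ, x, b :: l, b' :: l', hl, h => by
    by_cases hb : b = b'
    · subst hb
      refine measure_mono_null ?_ (volume_region_inter (fun k => hJ (k + 1)) (fun μ => x (b :: μ))
        (l := l) (l' := l') (by simpa using hl) (by rintro rfl; exact h rfl))
      exact Set.inter_subset_inter Set.inter_subset_right Set.inter_subset_right
    · refine measure_mono_null ?_ (volume_cut_eq_zero (hJ 0) (x []))
      rintro z ⟨⟨h1, -⟩, ⟨h2, -⟩⟩
      refine halfSpace_inter _ _ ?_
      cases b <;> cases b' <;> first | exact absurd rfl hb | exact ⟨h1, h2⟩ | exact ⟨h2, h1⟩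

/-- The action of the branch exchange at `ν` on cut parameters. -/
def flipParam {s : ℕ} (ν : List Bool) (x : List Bool → Fin s → ℝ) : List Bool → Fin s → ℝ :=
  fun μ => if μ = ν then -x μ else x (flipAt ν μ)

lemma region_flipParam {n s : ℕ} : ∀ (J : ℕ → Fin s → Fin n) (x : List Bool → Fin s → ℝ)
    {ν : List Bool} (_ : ‖x ν‖ = 1) (l : List Bool),
    region J (flipParam ν x) l = region J x (flipAt ν l)
  | _, _, [], _, [] => by simp [flipAt, region]
  | _, _, _ :: _, _, [] => by simp [flipAt, region]
  | J, x, [], hν, b :: l => by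
    simp only [flipAt, region]
    congr 1
    · ext z
      simp [halfSpace, flipParam, cut_neg _ hν, boolSign_not]
  | J, x, c :: ν, hν, b :: l => by
    by_cases hb : b = c
    · subst hb
      have := region_flipParam (fun k => J (k + 1)) (fun μ => x (b :: μ)) hν l
      simp only [flipAt, region, if_true]
      rw [← this]
      congr 1
      congr 1
      ext μ
      simp [flipParam, flipAt]
    · simp only [flipAt, region, hb, if_false]
      congr 1
      congr 1
      ext μ
      simp [flipParam, flipAt, hb]

/-- Off a null set, membership in a region is locally constant in the parameters. -/
lemma ae_eventually_mem_region_iff {n s : ℕ} : ∀ {J : ℕ → Fin s → Fin n}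
    (_ : ∀ k, Function.Injective (J k)) (x₀ : List Bool → Fin s → ℝ) (l : List Bool),
    ∀ᵐ z : Fin n → ℝ, ∀ᶠ x in 𝓝 x₀, (z ∈ region J x l ↔ z ∈ region J x₀ l)
  | _, _, _, [] => by simp [region]
  | J, hJ, x₀, b :: l => by
    have h1 := ae_eventually_mem_region_iff (fun k => hJ (k + 1)) (fun μ => x₀ (b :: μ)) l
    have h2 : ∀ᵐ z : Fin n → ℝ, cut (J 0) (x₀ []) z ≠ 0 := by
      rw [ae_iff]
      simpa using volume_cut_eq_zero (hJ 0) (x₀ [])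
    filter_upwards [h1, h2] with z hz1 hz2
    have c1 : Continuous fun x : List Bool → Fin s → ℝ => fun μ => x (b :: μ) := by fun_prop
    have c2 : Continuous fun x : List Bool → Fin s → ℝ => boolSign b * cut (J 0) (x []) z :=
      continuous_const.mul ((continuous_cut (J 0)).comp
        (f := fun x : List Bool → Fin s → ℝ => (x [], z)) (by fun_prop))
    have hne : boolSign b * cut (J 0) (x₀ []) z ≠ 0 := by
      refine mul_ne_zero ?_ hz2
      cases b <;> simp [boolSign]
    have e2 : ∀ᶠ x in 𝓝 x₀, (0 ≤ boolSign b * cut (J 0) (x []) z ↔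
        0 ≤ boolSign b * cut (J 0) (x₀ []) z) := by
      rcases hne.lt_or_gt with h | h
      · filter_upwards [c2.continuousAt.eventually_lt_const h] with x hx
        exact iff_of_false hx.not_ge h.not_ge
      · filter_upwards [c2.continuousAt.eventually_const_lt h] with x hx
        exact iff_of_true hx.le h.le
    filter_upwards [c1.continuousAt.eventually hz1, e2] with x hx1 hx2
    exact and_congr hx2 hx1

/-- The part of the unit cube in a region. -/
def cubePiece {n s : ℕ} (J : ℕ → Fin s → Fin n) (x : List Bool → Fin s → ℝ) (l : List Bool) :
    Set (Fin n → ℝ) := Set.Icc 0 1 ∩ region J x l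

lemma isCompact_cubePiece {n s : ℕ} (J : ℕ → Fin s → Fin n) (x : List Bool → Fin s → ℝ)
    (l : List Bool) : IsCompact (cubePiece J x l) := isCompact_Icc.inter_right (isClosed_region _ _ _)

lemma convex_cubePiece {n s : ℕ} (J : ℕ → Fin s → Fin n) (x : List Bool → Fin s → ℝ)
    (l : List Bool) : Convex ℝ (cubePiece J x l) := (convex_Icc _ _).inter (convex_region _ _ _)

lemma continuous_setIntegral_cubePiece {n s : ℕ} {J : ℕ → Fin s → Fin n}
    (hJ : ∀ k, Function.Injective (J k)) (l : List Bool) {E : Type*} [NormedAddCommGroup E]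
    [NormedSpace ℝ E] {u : (Fin n → ℝ) → E} (hu : Continuous u) :
    Continuous fun x : List Bool → Fin s → ℝ => ∫ z in cubePiece J x l, u z := by
  have e : ∀ x, ∫ z in cubePiece J x l, u z =
      ∫ z, (cubePiece J x l).indicator u z := fun x =>
    (integral_indicator (isCompact_cubePiece J x l).measurableSet).symm
  simp only [e]
  rw [continuous_iff_continuousAt]
  intro x₀
  refine continuousAt_of_dominated (bound := (Set.Icc 0 1).indicator fun z => ‖u z‖) ?_ ?_ ?_ ?_
  · exact Eventually.of_forall fun x =>
      hu.aestronglyMeasurable.indicator (isCompact_cubePiece J x l).measurableSet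
  · refine Eventually.of_forall fun x => Eventually.of_forall fun z => ?_
    rw [norm_indicator_eq_indicator_norm]
    exact Set.indicator_le_indicator_of_subset Set.inter_subset_left (fun _ => norm_nonneg _) z
  · rw [integrable_indicator_iff isClosed_Icc.measurableSet]
    exact hu.norm.continuousOn.integrableOn_compact isCompact_Icc
  · filter_upwards [ae_eventually_mem_region_iff hJ x₀ l] with z hz
    refine continuousAt_const.congr (f := fun _ => (cubePiece J x₀ l).indicator u z) ?_
    filter_upwards [hz] with x hx
    have : z ∈ cubePiece J x₀ l ↔ z ∈ cubePiece J x l := and_congr_right fun _ => hx.symm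
    by_cases h : z ∈ cubePiece J x l
    · rw [Set.indicator_of_mem h, Set.indicator_of_mem (this.2 h)]
    · rw [Set.indicator_of_notMem h, Set.indicator_of_notMem (mt this.1 h)]

lemma IsCompact.setAverage_mem {n : ℕ} {P : Set (Fin n → ℝ)} (hP : IsCompact P)
    (hc : Convex ℝ P) (h0 : volume.real P ≠ 0) : ⨍ z in P, z ∈ P := by
  refine hc.set_average_mem hP.isClosed ?_ hP.measure_ne_top
    (ae_restrict_mem hP.measurableSet) (continuous_id.continuousOn.integrableOn_compact hP)
  intro h
  simp [measureReal_def, h] at h0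

lemma setAverage_cubePiece_mem_Icc {n s : ℕ} (J : ℕ → Fin s → Fin n)
    (x : List Bool → Fin s → ℝ) (l : List Bool) :
    ⨍ z in cubePiece J x l, z ∈ Set.Icc (0 : Fin n → ℝ) 1 := by
  by_cases h0 : volume.real (cubePiece J x l) = 0
  · rw [setAverage_eq, h0]
    simp
  · exact ((isCompact_cubePiece J x l).setAverage_mem (convex_cubePiece J x l) h0).1

lemma continuous_volume_cubePiece {n s : ℕ} {J : ℕ → Fin s → Fin n}
    (hJ : ∀ k, Function.Injective (J k)) (l : List Bool) :
    Continuous fun x : List Bool → Fin s → ℝ => volume.real (cubePiece J x l) := by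
  simpa using continuous_setIntegral_cubePiece hJ l (u := fun _ => (1 : ℝ)) continuous_const

lemma continuous_volume_mul_setAverage {n s : ℕ} {J : ℕ → Fin s → Fin n}
    (hJ : ∀ k, Function.Injective (J k)) (l : List Bool) {f : (Fin n → ℝ) → ℝ}
    (hf : Continuous f) :
    Continuous fun x : List Bool → Fin s → ℝ =>
      volume.real (cubePiece J x l) * f (⨍ z in cubePiece J x l, z) := by
  have hv := continuous_volume_cubePiece hJ l
  have hi := continuous_setIntegral_cubePiece hJ l (u := fun z => z) continuous_id
  rw [continuous_iff_continuousAt]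
  intro x₀
  by_cases h0 : volume.real (cubePiece J x₀ l) = 0
  · obtain ⟨C, hC⟩ := (isCompact_Icc (a := (0 : Fin n → ℝ)) (b := 1)).exists_bound_of_continuousOn
      hf.continuousOn
    unfold ContinuousAt
    simp only [h0, zero_mul]
    have h1 : Tendsto (fun x : List Bool → Fin s → ℝ => volume.real (cubePiece J x l) * C)
        (𝓝 x₀) (𝓝 0) := by
      have := (hv.tendsto x₀).mul_const C
      rwa [h0, zero_mul] at this
    refine squeeze_zero_norm (fun x => ?_) h1
    rw [norm_mul, Real.norm_of_nonneg measureReal_nonneg]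
    exact mul_le_mul_of_nonneg_left (hC _ (setAverage_cubePiece_mem_Icc J x l)) measureReal_nonneg
  · simp only [setAverage_eq]
    exact hv.continuousAt.mul (hf.continuousAt.comp
      ((hv.continuousAt.inv₀ h0).smul hi.continuousAt))

lemma exists_partition {n m : ℕ} (h : ℕ) {J : ℕ → Fin (m + 1) → Fin n}
    (hJ : ∀ k, Function.Injective (J k)) {f : (Fin n → ℝ) → Fin m → ℝ} (hf : Continuous f) :
    ∃ (x : List Bool → Fin (m + 1) → ℝ) (v : ℝ) (y : Fin m → ℝ), 1 ≤ 2 ^ h * v ∧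
      ∀ l ∈ leaves h, volume.real (cubePiece J x l) = v ∧ f (⨍ z in cubePiece J x l, z) = y := by
  classical
  let N := {l : List Bool // l.length < h}
  have : Fintype N := (List.finite_length_lt Bool h).fintype
  let e : (N × Fin (m + 1) → ℝ) → List Bool → Fin (m + 1) → ℝ := fun x l k =>
    if hl : l.length < h then x (⟨l, hl⟩, k) else 0
  have he : Continuous e := by
    refine continuous_pi fun l => continuous_pi fun k => ?_
    by_cases hl : l.length < h
    · simp only [e, hl, dif_pos]; fun_prop
    · simp only [e, hl, dif_neg, not_false_eq_true]; fun_prop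
  let π : N → N → N := fun ν μ => ⟨flipAt ν.1 μ.1, by rw [length_flipAt]; exact μ.2⟩
  let G : (List Bool → Fin (m + 1) → ℝ) → Fin (m + 1) → List Bool → ℝ := fun x i l =>
    volume.real (cubePiece J x l) *
      (Fin.cons 1 (f (⨍ z in cubePiece J x l, z)) : Fin (m + 1) → ℝ) i
  have hGc : ∀ i l, Continuous fun x => G x i l := by
    intro i l
    refine Fin.cases ?_ (fun j => ?_) i
    · simpa [G] using continuous_volume_cubePiece hJ l
    · simpa [G] using continuous_volume_mul_setAverage hJ l (f := fun z => f z j)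
        ((continuous_apply j).comp hf)
  have hGf : ∀ {ν : List Bool} {x : List Bool → Fin (m + 1) → ℝ}, ‖x ν‖ = 1 → ∀ i l,
      G (flipParam ν x) i l = G x i (flipAt ν l) := by
    intro ν x hν i l
    have : cubePiece J (flipParam ν x) l = cubePiece J x (flipAt ν l) := by
      rw [cubePiece, region_flipParam J x hν, cubePiece]
    simp only [G, this]
  let Ψ : (N × Fin (m + 1) → ℝ) → N × Fin (m + 1) → ℝ := fun x q =>
    ∑ l ∈ leaves h, branchSign q.1.1 l * G (e x) q.2 l
  have hΨ : Continuous Ψ := continuous_pi fun q => continuous_finsetSum _ fun l _ =>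
    continuous_const.mul ((hGc _ _).comp he)
  obtain ⟨x, -, hx⟩ := exists_zero_of_nodeFlip (π := π) (rank := fun μ => wordRank μ.1)
    (fun ν μ => Subtype.ext (flipAt_flipAt _ _))
    (fun ν μ hνμ => Subtype.ext (wordRank_injective hνμ))
    (fun ν μ hνμ => Subtype.ext (flipAt_of_length_le (length_le_of_wordRank_le hνμ)))
    Ψ hΨ.continuousOn (by
      intro x hx ν i hi
      have hν : ‖e x ν.1‖ = 1 := by
        refine le_antisymm ?_ ?_
        · refine (pi_norm_le_iff_of_nonneg zero_le_one).2 fun k => ?_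
          simp only [e, ν.2, dif_pos]
          exact (norm_le_pi_norm x _).trans (mem_closedBall_zero_iff.1 hx)
        · refine le_trans (le_of_eq ?_) (norm_le_pi_norm (e x ν.1) i)
          simp only [e, ν.2, dif_pos]
          rw [Real.norm_eq_abs]
          exact hi.symm
      have hflip : e (nodeFlip π ν x) = flipParam ν.1 (e x) := by
        ext l k
        by_cases hl : l.length < h
        · by_cases hlν : l = ν.1
          · subst hlν
            simp only [e, flipParam, nodeFlip, dif_pos hl, if_true, Pi.neg_apply]
            exact if_pos rfl
          · have : (⟨l, hl⟩ : N) ≠ ν := fun h => hlν (congrArg Subtype.val h)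
            simp [e, flipParam, nodeFlip, hl, hlν, this, π, length_flipAt]
        · have hlν : l ≠ ν.1 := by rintro rfl; exact hl ν.2
          simp [e, flipParam, hl, hlν, length_flipAt]
      ext ⟨μ, j⟩
      have hmap : ∑ l ∈ leaves h, branchSign μ.1 l * G (e x) j (flipAt ν.1 l) =
          ∑ l ∈ leaves h, branchSign μ.1 (flipAt ν.1 l) * G (e x) j l := by
        refine Finset.sum_bij' (fun l _ => flipAt ν.1 l) (fun l _ => flipAt ν.1 l) ?_ ?_ ?_ ?_ ?_
        · intro l hl; simpa [mem_leaves, length_flipAt] using hl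
        · intro l hl; simpa [mem_leaves, length_flipAt] using hl
        · intro l _; exact flipAt_flipAt _ _
        · intro l _; exact flipAt_flipAt _ _
        · intro l _; simp only [flipAt_flipAt]
      simp only [Ψ, nodeFlip, hflip, hGf hν, hmap]
      by_cases hμ : μ = ν
      · subst hμ
        simp [branchSign_flipAt_self]
      · simp [hμ, branchSign_flipAt (fun h => hμ (Subtype.ext h)), π])
  have hG : ∀ i, ∀ l ∈ leaves h, ∀ l' ∈ leaves h, G (e x) i l = G (e x) i l' := by
    intro i l hl l' hl'
    refine eq_of_balanced (fun μ hμ => ?_) hl hl'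
    exact congrFun hx (⟨μ, hμ⟩, i)
  have hne : List.replicate h true ∈ leaves h := mem_leaves.2 (by simp)
  set l₀ := List.replicate h true
  have hvol : ∀ l ∈ leaves h, volume.real (cubePiece J (e x) l) =
      volume.real (cubePiece J (e x) l₀) := fun l hl => by
    simpa [G] using hG 0 l hl l₀ hne
  have hsum : (1 : ℝ) ≤ 2 ^ h * volume.real (cubePiece J (e x) l₀) := by
    have h1 : volume.real (Set.Icc (0 : Fin n → ℝ) 1) = 1 := by
      rw [measureReal_def, Real.volume_Icc_pi]
      simp
    have h2 : Set.Icc (0 : Fin n → ℝ) 1 ⊆ ⋃ l ∈ leaves h, cubePiece J (e x) l := by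
      intro z hz
      obtain ⟨l, hl, hzl⟩ := exists_mem_region z h J (e x)
      exact Set.mem_biUnion hl ⟨hz, hzl⟩
    rw [← h1]
    refine (measureReal_mono h2 ?_).trans ((measureReal_biUnion_finset_le _ _).trans_eq ?_)
    · refine (measure_biUnion_lt_top (leaves h).finite_toSet fun l _ => ?_).ne
      exact (isCompact_cubePiece J (e x) l).measure_lt_top
    · rw [Finset.sum_congr rfl hvol, Finset.sum_const, card_leaves]
      simp
  have hpos : volume.real (cubePiece J (e x) l₀) ≠ 0 := by
    intro h0
    rw [h0, mul_zero] at hsum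
    linarith
  refine ⟨e x, _, f (⨍ z in cubePiece J (e x) l₀, z), hsum, fun l hl => ⟨hvol l hl, ?_⟩⟩
  ext j
  have := hG j.succ l hl l₀ hne
  simp only [G, Fin.cons_succ, hvol l hl] at this
  exact mul_left_cancel₀ hpos this

lemma continuous_coordProj {n s : ℕ} (J : Fin s → Fin n) : Continuous (coordProj J) := by
  unfold coordProj
  fun_prop

lemma volume_coordProj_halfSpace_add_le {n s : ℕ} (J : Fin s → Fin n) (t : Fin s → ℝ)
    {K : Set (Fin n → ℝ)} (hK : IsCompact K) :
    volume (coordProj J '' (K ∩ halfSpace J t true)) +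
      volume (coordProj J '' (K ∩ halfSpace J t false)) ≤ volume (coordProj J '' K) := by
  have hm : MeasurableSet (coordProj J '' (K ∩ halfSpace J t false)) :=
    ((hK.inter_right (isClosed_halfSpace J t false)).image (continuous_coordProj J)).measurableSet
  rw [← measure_union_add_inter _ hm]
  have h0 : volume (coordProj J '' (K ∩ halfSpace J t true) ∩
      coordProj J '' (K ∩ halfSpace J t false)) = 0 := by
    refine measure_mono_null ?_ (volume_cut_eq_zero (J := id) Function.injective_id t)
    rintro _ ⟨⟨z, ⟨-, hz⟩, rfl⟩, ⟨z', ⟨-, hz'⟩, he⟩⟩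
    refine halfSpace_inter id t ⟨?_, ?_⟩
    · exact hz
    · rw [← he]; exact hz'
  rw [h0, add_zero, ← Set.image_union]
  exact measure_mono (Set.image_mono (Set.union_subset Set.inter_subset_left
    Set.inter_subset_left))

lemma sum_volume_coordProj_region_le {n s : ℕ} (I : Fin s → Fin n) : ∀ (h : ℕ)
    (J : ℕ → Fin s → Fin n) (x : List Bool → Fin s → ℝ) {K : Set (Fin n → ℝ)} (_ : IsCompact K),
    ∑ l ∈ leaves h, volume (coordProj I '' (K ∩ region J x l)) ≤
      2 ^ (∑ k ∈ Finset.range h, if J k = I then 0 else 1) * volume (coordProj I '' K)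
  | 0, J, x, K, hK => by simp [leaves, region]
  | h + 1, J, x, K, hK => by
    have ih : ∀ b, ∑ l ∈ leaves h, volume (coordProj I '' (K ∩ region J x (b :: l))) ≤
        2 ^ (∑ k ∈ Finset.range h, if J (k + 1) = I then 0 else 1) *
          volume (coordProj I '' (K ∩ halfSpace (J 0) (x []) b)) := by
      intro b
      simpa only [region, Set.inter_assoc] using sum_volume_coordProj_region_le I h (fun k => J (k + 1)) (fun μ => x (b :: μ))
        (hK.inter_right (isClosed_halfSpace (J 0) (x []) b))
    rw [sum_leaves_succ, Finset.sum_range_succ', pow_add]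
    refine (add_le_add (ih true) (ih false)).trans ?_
    rw [← mul_add, mul_assoc]
    gcongr
    split_ifs with h0
    · rw [h0, pow_zero, one_mul]
      exact volume_coordProj_halfSpace_add_le I (x []) hK
    · rw [pow_one, two_mul]
      gcongr <;> exact Set.inter_subset_left

lemma exists_frequent_sequence (E : Type*) [Fintype E] [Nonempty E] [DecidableEq E] (r : ℕ) :
    ∃ (h : ℕ) (J : ℕ → E), ∀ I, r + (∑ k ∈ Finset.range h, if J k = I then 0 else 1) ≤ h := by
  set c := Fintype.card E with hc
  have hc0 : 0 < c := Fintype.card_pos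
  let eq := Fintype.equivFin E
  refine ⟨r * c, fun k => eq.symm ⟨k % c, Nat.mod_lt _ hc0⟩, fun I => ?_⟩
  set J : ℕ → E := fun k => eq.symm ⟨k % c, Nat.mod_lt _ hc0⟩
  have h1 : (∑ k ∈ Finset.range (r * c), if J k = I then 1 else 0) +
      (∑ k ∈ Finset.range (r * c), if J k = I then 0 else 1) = r * c := by
    rw [← Finset.sum_add_distrib, Finset.sum_congr rfl (g := fun _ => 1)]
    · simp
    · intro k _; split_ifs <;> rfl
  have h2 : r ≤ ∑ k ∈ Finset.range (r * c), if J k = I then 1 else 0 := by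
    rw [← Finset.card_filter]
    conv_lhs => rw [← Finset.card_range r]
    refine Finset.card_le_card_of_injOn (fun j => j * c + (eq I : ℕ)) ?_ ?_
    · intro j hj
      have hj' : j < r := by simpa using hj
      have hlt := (eq I).2
      simp only [Finset.coe_filter, Finset.mem_range, Set.mem_ofPred_eq]
      constructor
      · calc j * c + (eq I : ℕ) < j * c + c := by omega
          _ = (j + 1) * c := by ring
          _ ≤ r * c := Nat.mul_le_mul_right _ hj'
      · simp only [J]
        rw [Equiv.symm_apply_eq]
        ext
        simp only
        rw [mul_comm, Nat.mul_add_mod, Nat.mod_eq_of_lt hlt]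
    · intro j _ j' _ hjj
      simp only at hjj
      exact Nat.eq_of_mul_eq_mul_right hc0 (by omega)
  omega

lemma measurable_gridCode {n : ℕ} (p : ℕ) : Measurable (gridCode (n := n) p) := by
  refine measurable_pi_lambda _ fun i => ?_
  exact Nat.measurable_floor.comp ((measurable_pi_apply i).const_mul _)

lemma gridCode_bounds {n p : ℕ} (hp : 0 < p) {x : Fin n → ℝ} (hx : 0 ≤ x) (i : Fin n) :
    (gridCode p x i : ℝ) / p ≤ x i ∧ x i < ((gridCode p x i : ℝ) + 1) / p := by
  have hp' : (0 : ℝ) < p := by exact_mod_cast hp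
  have hxi : 0 ≤ x i := hx i
  rw [div_le_iff₀ hp', lt_div_iff₀ hp', mul_comm (x i)]
  exact ⟨Nat.floor_le (by positivity), Nat.lt_floor_add_one _⟩

lemma dist_le_of_gridCode_eq {n p : ℕ} (hp : 0 < p) {x y : Fin n → ℝ} (hx : 0 ≤ x) (hy : 0 ≤ y)
    (h : gridCode p x = gridCode p y) : dist x y ≤ 1 / p := by
  refine (dist_pi_le_iff (by positivity)).2 fun i => ?_
  have h1 := gridCode_bounds hp hx i
  have h2 := gridCode_bounds hp hy i
  rw [h] at h1
  rw [add_div] at h1 h2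
  rw [Real.dist_eq, abs_sub_le_iff]
  constructor <;> linarith [h1.1, h1.2, h2.1, h2.2]

lemma gridCode_le {n p : ℕ} {x : Fin n → ℝ} (hx : x ∈ Set.Icc (0 : Fin n → ℝ) 1)
    (i : Fin n) : gridCode p x i ≤ p := by
  refine Nat.floor_le_of_le ?_
  have h1 : x i ≤ 1 := hx.2 i
  exact mul_le_of_le_one_right (by positivity) h1

/-- A convex body in the cube none of whose projections to `m + 1` coordinates is as large as a
grid cell has a sizable part of its volume near its barycenter. -/
lemma volume_le_mul_volume_inter_barycenter {n m p : ℕ} (hp : 0 < p) {P : Set (Fin n → ℝ)}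
    (hPc : IsCompact P) (hc : Convex ℝ P) (hP : P ⊆ Set.Icc 0 1)
    (hJ : ∀ J : Fin (m + 1) → Fin n, Function.Injective J →
      volume (coordProj J '' P) < ENNReal.ofReal ((1 / p : ℝ) ^ (m + 1))) :
    volume.real P ≤ 4 ^ n * p ^ m *
      volume.real (P ∩ Metric.closedBall (⨍ x in P, x) (1 / p)) := by
  classical
  set 𝒞 := (Fintype.piFinset fun _ : Fin n => Finset.range (p + 1)).filter
    fun C => ∃ x ∈ P, gridCode p x = C with h𝒞
  have h1 := volume_le_card_mul_barycenter hPc hc (gridCode p) 𝒞 (r := 1 / p)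
    (fun i => measurable_gridCode p (measurableSet_singleton i))
    (fun x hx => by
      simp only [h𝒞, Finset.mem_filter, Fintype.mem_piFinset, Finset.mem_range]
      exact ⟨fun i => Nat.lt_succ_of_le (gridCode_le (hP hx) i), x, hx, rfl⟩)
    (fun x hx y hy h => dist_le_of_gridCode_eq hp (hP hx).1 (hP hy).1 h)
  have h2 := card_gridCode_le hp hc hP hJ 𝒞 fun C hC => (Finset.mem_filter.1 hC).2
  refine h1.trans (mul_le_mul_of_nonneg_right ?_ measureReal_nonneg)
  exact_mod_cast h2

/-- Some fiber of a continuous map from the `n`-cube to `ℝ^m` meets many grid cells. -/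
theorem exists_fiber_card_gridCode {n m p : ℕ} (hp : 0 < p) {f : (Fin n → ℝ) → Fin m → ℝ}
    (hf : Continuous f) : ∃ y, ∀ 𝒴 : Finset (Fin n → ℕ),
      (∀ x ∈ Set.Icc (0 : Fin n → ℝ) 1, f x = y → gridCode p x ∈ 𝒴) →
      (p : ℝ) ^ n ≤ 2 * 12 ^ n * 𝒴.card * p ^ m := by
  classical
  have hp1 : (1 : ℝ) ≤ p := by exact_mod_cast hp
  have hp0 : (0 : ℝ) < p := by exact_mod_cast hp
  rcases le_or_gt n m with hnm | hnm
  · refine ⟨f 0, fun 𝒴 h𝒴 => ?_⟩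
    have h1 : (1 : ℝ) ≤ 𝒴.card := by
      exact_mod_cast Finset.card_pos.2 ⟨_, h𝒴 0 (by simp) rfl⟩
    have h2 : (1 : ℝ) ≤ 12 ^ n := one_le_pow₀ (by norm_num)
    calc (p : ℝ) ^ n ≤ p ^ m := pow_le_pow_right₀ hp1 hnm
      _ = 1 * p ^ m := (one_mul _).symm
      _ ≤ 2 * 12 ^ n * 𝒴.card * p ^ m := by
          gcongr
          nlinarith [mul_le_mul h2 h1 zero_le_one (by positivity)]
  set E := {J : Fin (m + 1) → Fin n // Function.Injective J}
  have : Nonempty E := ⟨⟨Fin.castLE hnm, Fin.castLE_injective hnm⟩⟩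
  obtain ⟨r, hr⟩ := exists_nat_ge (2 * (Fintype.card E : ℝ) * p ^ (m + 1))
  obtain ⟨h, J, hJ⟩ := exists_frequent_sequence E r
  obtain ⟨x, v, y, hv, hxy⟩ := exists_partition h (J := fun k => (J k).1) (fun k => (J k).2) hf
  refine ⟨y, fun 𝒴 h𝒴 => ?_⟩
  have hvpos : 0 < v := by
    by_contra! hv0
    have : (2 : ℝ) ^ h * v ≤ 0 := mul_nonpos_of_nonneg_of_nonpos (by positivity) hv0
    linarith
  let P : List Bool → Set (Fin n → ℝ) := cubePiece (fun k => (J k).1) x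
  have hPc : ∀ l, IsCompact (P l) := isCompact_cubePiece _ x
  set bad : E → Finset (List Bool) := fun I => (leaves h).filter fun l =>
    ENNReal.ofReal ((1 / p : ℝ) ^ (m + 1)) ≤ volume (coordProj I.1 '' P l) with hbad
  have hcube : ∀ I : E, volume (coordProj I.1 '' (Set.Icc (0 : Fin n → ℝ) 1)) ≤ 1 := by
    intro I
    have : coordProj I.1 '' (Set.Icc (0 : Fin n → ℝ) 1) ⊆ Set.Icc 0 1 := by
      rintro _ ⟨z, hz, rfl⟩
      exact ⟨fun k => hz.1 _, fun k => hz.2 _⟩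
    refine (measure_mono this).trans ?_
    rw [Real.volume_Icc_pi]
    simp
  have hbadc : ∀ I, ((bad I).card : ℝ) * (1 / p : ℝ) ^ (m + 1) * 2 ^ r ≤ 2 ^ h := by
    intro I
    have h1 := sum_volume_coordProj_region_le I.1 h (fun k => (J k).1) x
      (isCompact_Icc (a := (0 : Fin n → ℝ)) (b := 1))
    have h2 : (bad I).card • ENNReal.ofReal ((1 / p : ℝ) ^ (m + 1)) ≤
        ∑ l ∈ leaves h, volume (coordProj I.1 '' P l) :=
      (Finset.card_nsmul_le_sum _ _ _ fun l hl => (Finset.mem_filter.1 hl).2).trans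
        (Finset.sum_le_sum_of_subset (Finset.filter_subset _ _))
    have h3 := (h2.trans h1).trans (mul_le_mul_right (hcube I) _)
    simp only [Subtype.val_inj] at h3
    rw [mul_one, nsmul_eq_mul] at h3
    have h4 := ENNReal.toReal_mono (by simp) h3
    rw [ENNReal.toReal_mul, ENNReal.toReal_ofReal (by positivity), ENNReal.toReal_pow] at h4
    simp only [ENNReal.toReal_natCast, ENNReal.toReal_ofNat] at h4
    calc _ ≤ (2 : ℝ) ^ (∑ k ∈ Finset.range h, if J k = I then 0 else 1) * 2 ^ r := by gcongr
      _ = 2 ^ (r + ∑ k ∈ Finset.range h, if J k = I then 0 else 1) := by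
          rw [← pow_add, add_comm]
      _ ≤ 2 ^ h := pow_le_pow_right₀ (by norm_num) (hJ I)
  set good := leaves h \ Finset.univ.biUnion bad with hgood
  have hgoodc : (2 : ℝ) ^ h ≤ 2 * good.card := by
    have h1 : (leaves h).card ≤ good.card + (Finset.univ.biUnion bad).card := by
      rw [hgood]
      exact Finset.card_le_card_sdiff_add_card
    have h2 : ((Finset.univ.biUnion bad).card : ℝ) ≤ ∑ I, ((bad I).card : ℝ) := by
      exact_mod_cast Finset.card_biUnion_le
    have h3 : ∀ I, ((bad I).card : ℝ) ≤ 2 ^ h * p ^ (m + 1) / 2 ^ r := by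
      intro I
      have := hbadc I
      rw [one_div, inv_pow] at this
      rw [le_div_iff₀ (by positivity)]
      calc ((bad I).card : ℝ) * 2 ^ r
          = ((bad I).card * ((p : ℝ) ^ (m + 1))⁻¹ * 2 ^ r) * p ^ (m + 1) := by field_simp
        _ ≤ _ := by gcongr
    have h4 : ∑ I, ((bad I).card : ℝ) ≤ Fintype.card E * (2 ^ h * p ^ (m + 1) / 2 ^ r) := by
      refine (Finset.sum_le_card_nsmul _ _ _ fun I _ => h3 I).trans_eq ?_
      rw [nsmul_eq_mul, Finset.card_univ]
    have h5 : (Fintype.card E : ℝ) * (2 ^ h * p ^ (m + 1) / 2 ^ r) ≤ 2 ^ h / 2 := by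
      have : (r : ℝ) ≤ 2 ^ r := by exact_mod_cast (Nat.lt_two_pow_self (n := r)).le
      rw [mul_div_assoc', div_le_div_iff₀ (by positivity) (by norm_num)]
      calc (Fintype.card E : ℝ) * (2 ^ h * p ^ (m + 1)) * 2
          = 2 ^ h * (2 * (Fintype.card E : ℝ) * p ^ (m + 1)) := by ring
        _ ≤ 2 ^ h * 2 ^ r := by gcongr; linarith
    rw [card_leaves] at h1
    have h1' : (2 : ℝ) ^ h ≤ good.card + (Finset.univ.biUnion bad).card := by exact_mod_cast h1
    linarith
  set B : List Bool → Set (Fin n → ℝ) := fun l =>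
    P l ∩ Metric.closedBall (⨍ z in P l, z) (1 / p) with hB
  have hgl : ∀ l ∈ good, l ∈ leaves h := fun l hl => (Finset.mem_sdiff.1 hl).1
  have hgoodv : ∀ l ∈ good, v ≤ 4 ^ n * p ^ m * volume.real (B l) := by
    intro l hl
    rw [← (hxy l (hgl l hl)).1]
    refine volume_le_mul_volume_inter_barycenter hp (hPc l) (convex_cubePiece _ x l)
      Set.inter_subset_left fun I hI => ?_
    by_contra! hlt
    exact (Finset.mem_sdiff.1 hl).2 (Finset.mem_biUnion.2 ⟨⟨I, hI⟩, Finset.mem_univ _,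
      Finset.mem_filter.2 ⟨hgl l hl, hlt⟩⟩)
  have hBm : ∀ l, MeasurableSet (B l) := fun l =>
    ((hPc l).inter_right Metric.isClosed_closedBall).measurableSet
  have hBt : ∀ l, volume (B l) ≠ ∞ := fun l =>
    ((hPc l).inter_right Metric.isClosed_closedBall).measure_ne_top
  have hBd : (good : Set (List Bool)).Pairwise (Function.onFun (AEDisjoint volume) B) := by
    intro l hl l' hl' hne
    refine measure_mono_null ?_ (volume_region_inter (fun k => (J k).2) x
      (l := l) (l' := l') ?_ hne)
    · exact Set.inter_subset_inter (fun z hz => hz.1.2) (fun z hz => hz.1.2)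
    · rw [mem_leaves.1 (hgl l hl), mem_leaves.1 (hgl l' hl')]
  have hsum : ∑ l ∈ good, volume.real (B l) = volume.real (⋃ l ∈ good, B l) :=
    (measureReal_biUnion_finset₀ hBd (fun l _ => (hBm l).nullMeasurableSet)
      (fun l _ => hBt l)).symm
  set Q : (Fin n → ℕ) → Set (Fin n → ℝ) := fun C =>
    Set.Icc (fun i => ((C i : ℝ) - 1) / p) (fun i => ((C i : ℝ) + 2) / p) with hQ
  have hQv : ∀ C, volume.real (Q C) = (3 / p) ^ n := by
    intro C
    rw [hQ, measureReal_def, Real.volume_Icc_pi]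
    have : ∀ i, ((C i : ℝ) + 2) / p - ((C i : ℝ) - 1) / p = 3 / p := fun i => by ring
    simp only [this, Finset.prod_const, Finset.card_univ, Fintype.card_fin]
    rw [ENNReal.toReal_pow, ENNReal.toReal_ofReal (by positivity)]
  have hsub : ⋃ l ∈ good, B l ⊆ ⋃ C ∈ 𝒴, Q C := by
    refine Set.iUnion₂_subset fun l hl => ?_
    have hvl := (hxy l (hgl l hl)).1
    set c := ⨍ z in P l, z with hcd
    have hc : c ∈ P l := (hPc l).setAverage_mem (convex_cubePiece _ x l) (by
      rw [show volume.real (P l) = v from hvl]; exact hvpos.ne')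
    refine fun z hz => Set.mem_biUnion (h𝒴 c hc.1 (hxy l (hgl l hl)).2) ?_
    have hd : ∀ i, |z i - c i| ≤ 1 / p := fun i =>
      (dist_le_pi_dist z c i).trans (Metric.mem_closedBall.1 hz.2)
    constructor
    · intro i
      have h1 := (gridCode_bounds hp hc.1.1 i).1
      have h2 := (abs_le.1 (hd i)).1
      simp only [sub_div]
      linarith
    · intro i
      have h1 := (gridCode_bounds hp hc.1.1 i).2
      have h2 := (abs_le.1 (hd i)).2
      have h3 : ((gridCode p c i : ℝ) + 2) / p = ((gridCode p c i : ℝ) + 1) / p + 1 / p := by ring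
      simp only [h3]
      linarith
  have hvolU : volume.real (⋃ l ∈ good, B l) ≤ 𝒴.card * (3 / p) ^ n := by
    refine (measureReal_mono hsub ?_).trans ((measureReal_biUnion_finset_le _ _).trans_eq ?_)
    · exact (measure_biUnion_lt_top 𝒴.finite_toSet fun C _ => isCompact_Icc.measure_lt_top).ne
    · rw [Finset.sum_congr rfl fun C _ => hQv C, Finset.sum_const, nsmul_eq_mul]
  have hgv : (good.card : ℝ) * v ≤ 4 ^ n * p ^ m * (𝒴.card * (3 / p) ^ n) := by
    calc (good.card : ℝ) * v = ∑ _l ∈ good, v := by rw [Finset.sum_const, nsmul_eq_mul]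
      _ ≤ ∑ l ∈ good, 4 ^ n * p ^ m * volume.real (B l) := Finset.sum_le_sum hgoodv
      _ = 4 ^ n * p ^ m * volume.real (⋃ l ∈ good, B l) := by rw [← Finset.mul_sum, hsum]
      _ ≤ _ := by gcongr
  have hone : (1 : ℝ) ≤ 2 * (4 ^ n * p ^ m * (𝒴.card * (3 / p) ^ n)) := by
    refine hv.trans ((mul_le_mul_of_nonneg_right hgoodc hvpos.le).trans ?_)
    rw [mul_assoc]
    linarith
  calc (p : ℝ) ^ n = 1 * p ^ n := (one_mul _).symm
    _ ≤ 2 * (4 ^ n * p ^ m * (𝒴.card * (3 / p) ^ n)) * p ^ n := by gcongr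
    _ = 2 * (4 ^ n * 3 ^ n) * 𝒴.card * p ^ m := by
        rw [div_pow]; field_simp
    _ = _ := by rw [← mul_pow]; norm_num

section DynamicalMetric

variable {X : Type*} {T : X → X} {d : X → X → ℝ} {N : ℕ}

lemma finite_orbit_dist (T : X → X) (d : X → X → ℝ) (N : ℕ) (x y : X) :
    {r : ℝ | ∃ n, n < N ∧ r = d (T^[n] x) (T^[n] y)}.Finite := by
  refine ((Set.finite_lt_nat N).image fun n => d (T^[n] x) (T^[n] y)).subset ?_
  rintro r ⟨n, hn, rfl⟩
  exact ⟨n, hn, rfl⟩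

lemma le_dynDist (T : X → X) (d : X → X → ℝ) {n : ℕ} (hn : n < N) (x y : X) :
    d (T^[n] x) (T^[n] y) ≤ dynDist T d N x y :=
  le_csSup (finite_orbit_dist T d N x y).bddAbove ⟨n, hn, rfl⟩

lemma dynDist_lt_iff {r : ℝ} (hr : 0 < r) {x y : X} :
    dynDist T d N x y < r ↔ ∀ n < N, d (T^[n] x) (T^[n] y) < r := by
  refine ⟨fun h n hn => (le_dynDist T d hn x y).trans_lt h, fun h => ?_⟩
  rcases Set.eq_empty_or_nonempty {r : ℝ | ∃ n, n < N ∧ r = d (T^[n] x) (T^[n] y)} with he | hne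
  · rw [dynDist, he, Real.sSup_empty]
    exact hr
  · obtain ⟨n, hn, heq⟩ := hne.csSup_mem (finite_orbit_dist T d N x y)
    rw [dynDist, heq]
    exact h n hn

lemma dist_lt_of_setEDiam_lt {ρ : X → X → ℝ} {ε : ℝ} {U : Set X}
    (hU : setEDiam ρ U < ENNReal.ofReal ε) {x y : X} (hx : x ∈ U) (hy : y ∈ U) :
    ρ x y < ε := by
  have h1 : ENNReal.ofReal (ρ x y) ≤ setEDiam ρ U :=
    le_iSup₂_of_le x hx (le_iSup₂_of_le y hy le_rfl)
  by_contra! h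
  exact absurd (h1.trans_lt hU) (not_lt.2 (ENNReal.ofReal_le_ofReal h))

variable [TopologicalSpace X]

lemma isOpen_dynDist_lt (hT : Continuous T) (hd : Continuous fun z : X × X => d z.1 z.2)
    {r : ℝ} (hr : 0 < r) (x : X) : IsOpen {y | dynDist T d N x y < r} := by
  simp only [dynDist_lt_iff hr]
  have : {y | ∀ n < N, d (T^[n] x) (T^[n] y) < r} =
      ⋂ n ∈ Set.Iio N, {y | d (T^[n] x) (T^[n] y) < r} := by
    ext y; simp
  rw [this]
  refine (Set.finite_Iio N).isOpen_biInter fun n _ => ?_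
  exact isOpen_lt (hd.comp (continuous_const.prodMk (hT.iterate n))) continuous_const

lemma isOpen_of_rOpen (hT : Continuous T) (hd : Continuous fun z : X × X => d z.1 z.2)
    (hself : ∀ x, d x x = 0) {U : Set X} (hU : ROpen (dynDist T d N) U) : IsOpen U := by
  refine isOpen_iff_mem_nhds.2 fun x hx => ?_
  obtain ⟨δ, hδ, h⟩ := hU x hx
  refine mem_of_superset ((isOpen_dynDist_lt hT hd hδ x).mem_nhds ?_) h
  exact (dynDist_lt_iff hδ).2 fun n _ => by rw [hself]; exact hδ

lemma exists_dynDist_cover [CompactSpace X] (hT : Continuous T)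
    (hd : Continuous fun z : X × X => d z.1 z.2) (hself : ∀ x, d x x = 0)
    (hsymm : ∀ x y, d x y = d y x) (htri : ∀ x y z, d x z ≤ d x y + d y z)
    {ε : ℝ} (hε : 0 < ε) (N : ℕ) : ∃ n : ℕ, ∃ U : Fin n → Set X,
      (∀ i, ROpen (dynDist T d N) (U i)) ∧
      (∀ i, setEDiam (dynDist T d N) (U i) < ENNReal.ofReal ε) ∧ Set.univ ⊆ ⋃ i, U i := by
  have hr : 0 < ε / 3 := by positivity
  obtain ⟨t, ht⟩ := isCompact_univ.elim_finite_subcover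
    (fun x => {y | dynDist T d N x y < ε / 3}) (fun x => isOpen_dynDist_lt hT hd hr x)
    (fun x _ => Set.mem_iUnion.2 ⟨x, (dynDist_lt_iff hr).2 fun n _ => by rw [hself]; exact hr⟩)
  refine ⟨t.card, fun i => {y | dynDist T d N (t.equivFin.symm i).1 y < ε / 3}, ?_, ?_, ?_⟩
  · intro i y hy
    rw [Set.mem_ofPred_eq] at hy
    refine ⟨ε / 3 - dynDist T d N (t.equivFin.symm i).1 y, by linarith, fun z hz => ?_⟩
    refine (dynDist_lt_iff hr).2 fun n hn => ?_
    have h1 := le_dynDist T d hn (t.equivFin.symm i).1 y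
    have h2 := le_dynDist T d hn y z
    have h3 := htri (T^[n] (t.equivFin.symm i).1) (T^[n] y) (T^[n] z)
    linarith
  · intro i
    refine lt_of_le_of_lt (b := ENNReal.ofReal (2 * (ε / 3))) ?_
      ((ENNReal.ofReal_lt_ofReal_iff hε).2 (by linarith))
    refine iSup₂_le fun y hy => iSup₂_le fun z hz => ENNReal.ofReal_le_ofReal ?_
    refine ((dynDist_lt_iff (by positivity)).2 fun n hn => ?_).le
    have h1 := (dynDist_lt_iff hr).1 hy n hn
    have h2 := (dynDist_lt_iff hr).1 hz n hn
    have h3 := htri (T^[n] y) (T^[n] (t.equivFin.symm i).1) (T^[n] z)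
    rw [hsymm (T^[n] y) (T^[n] (t.equivFin.symm i).1)] at h3
    linarith
  · intro y hy
    obtain ⟨x, hx, hxy⟩ := Set.mem_iUnion₂.1 (ht hy)
    refine Set.mem_iUnion.2 ⟨t.equivFin ⟨x, hx⟩, ?_⟩
    simpa using hxy

end DynamicalMetric

section CoveringNumber

variable {X Y : Type*} {ρ : X → X → ℝ} {ε : ℝ}

lemma covNum_spec (hcov : ∃ n : ℕ, ∃ U : Fin n → Set X, (∀ i, ROpen ρ (U i)) ∧
      (∀ i, setEDiam ρ (U i) < ENNReal.ofReal ε) ∧ Set.univ ⊆ ⋃ i, U i) (E : Set X) :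
    ∃ U : Fin (covNum ρ ε E) → Set X, (∀ i, ROpen ρ (U i)) ∧
      (∀ i, setEDiam ρ (U i) < ENNReal.ofReal ε) ∧ E ⊆ ⋃ i, U i := by
  obtain ⟨n, U, h1, h2, h3⟩ := hcov
  exact Nat.sInf_mem (s := {n : ℕ | ∃ U : Fin n → Set X, (∀ i, ROpen ρ (U i)) ∧
    (∀ i, setEDiam ρ (U i) < ENNReal.ofReal ε) ∧ E ⊆ ⋃ i, U i})
    ⟨n, U, h1, h2, (Set.subset_univ E).trans h3⟩

lemma covNum_le_exp_supLogCov (hcov : ∃ n : ℕ, ∃ U : Fin n → Set X, (∀ i, ROpen ρ (U i)) ∧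
      (∀ i, setEDiam ρ (U i) < ENNReal.ofReal ε) ∧ Set.univ ⊆ ⋃ i, U i)
    (π : X → Y) (y : Y) :
    (covNum ρ ε (π ⁻¹' {y}) : ℝ) ≤ Real.exp (supLogCov π ρ ε) := by
  obtain ⟨n, U, h1, h2, h3⟩ := hcov
  have hle : ∀ y, covNum ρ ε (π ⁻¹' {y}) ≤ n := fun y =>
    Nat.sInf_le ⟨U, h1, h2, (Set.subset_univ _).trans h3⟩
  have hbdd : BddAbove (Set.range fun y => Real.log (covNum ρ ε (π ⁻¹' {y}) : ℝ)) := by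
    refine ⟨Real.log n, ?_⟩
    rintro _ ⟨y, rfl⟩
    rcases Nat.eq_zero_or_pos (covNum ρ ε (π ⁻¹' {y})) with h0 | h0
    · simp only [h0, Nat.cast_zero, Real.log_zero]
      exact Real.log_natCast_nonneg n
    · exact Real.log_le_log (by exact_mod_cast h0) (by exact_mod_cast hle y)
  rcases Nat.eq_zero_or_pos (covNum ρ ε (π ⁻¹' {y})) with h0 | h0
  · rw [h0, Nat.cast_zero]
    positivity
  · rw [← Real.log_le_iff_le_exp (by exact_mod_cast h0)]
    exact le_ciSup hbdd y

end CoveringNumber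

section ShiftMetric

variable {a : ℕ}

lemma cubeDist_eq_dist (x y : Cube a) : cubeDist x y = dist x y := by
  rw [cubeDist, ← dist_eq_norm]
  simp only [dist_pi_def]
  rfl

lemma cubeDist_le_one (x y : Cube a) : cubeDist x y ≤ 1 := by
  rw [cubeDist_eq_dist]
  refine (dist_pi_le_iff zero_le_one).2 fun i => ?_
  exact Real.dist_le_of_mem_Icc_01 (x i).2 (y i).2

lemma summable_two_zpow_neg_abs : Summable fun n : ℤ => (2 : ℝ) ^ (-|n|) := by
  have h : Summable fun n : ℕ => (2 : ℝ) ^ (-|(n : ℤ)|) := by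
    refine (summable_geometric_two).congr fun n => ?_
    simp [zpow_neg]
  refine Summable.of_nat_of_neg h ?_
  simpa using h

lemma shiftDist_term_nonneg (x y : FullShift a) (n : ℤ) :
    0 ≤ (2 : ℝ) ^ (-|n|) * cubeDist (x n) (y n) := by
  rw [cubeDist_eq_dist]
  positivity

lemma shiftDist_term_le (x y : FullShift a) (n : ℤ) :
    (2 : ℝ) ^ (-|n|) * cubeDist (x n) (y n) ≤ (2 : ℝ) ^ (-|n|) :=
  mul_le_of_le_one_right (by positivity) (cubeDist_le_one _ _)

lemma summable_shiftDist (x y : FullShift a) :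
    Summable fun n : ℤ => (2 : ℝ) ^ (-|n|) * cubeDist (x n) (y n) :=
  summable_two_zpow_neg_abs.of_nonneg_of_le (shiftDist_term_nonneg x y) (shiftDist_term_le x y)

lemma cubeDist_zero_le_shiftDist (x y : FullShift a) :
    cubeDist (x 0) (y 0) ≤ shiftDist x y := by
  have := (summable_shiftDist x y).le_tsum 0 fun n _ => shiftDist_term_nonneg x y n
  simpa [shiftDist] using this

lemma shiftDist_self (x : FullShift a) : shiftDist x x = 0 := by
  simp [shiftDist, cubeDist_eq_dist]

lemma shiftDist_comm (x y : FullShift a) : shiftDist x y = shiftDist y x := by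
  simp only [shiftDist, cubeDist_eq_dist, dist_comm]

lemma shiftDist_triangle (x y z : FullShift a) :
    shiftDist x z ≤ shiftDist x y + shiftDist y z := by
  rw [shiftDist, shiftDist, shiftDist, ← (summable_shiftDist x y).tsum_add (summable_shiftDist y z)]
  refine (summable_shiftDist x z).tsum_le_tsum (fun n => ?_)
    ((summable_shiftDist x y).add (summable_shiftDist y z))
  rw [← mul_add]
  refine mul_le_mul_of_nonneg_left ?_ (by positivity)
  simp only [cubeDist_eq_dist]
  exact dist_triangle _ _ _

lemma continuous_shiftDist : Continuous fun z : FullShift a × FullShift a => shiftDist z.1 z.2 := by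
  refine continuous_tsum (fun n => ?_) summable_two_zpow_neg_abs fun n z => ?_
  · simp only [cubeDist_eq_dist]
    fun_prop
  · rw [Real.norm_of_nonneg (shiftDist_term_nonneg _ _ n)]
    exact shiftDist_term_le _ _ n

lemma continuous_shift {α : Type*} [TopologicalSpace α] :
    Continuous (shift : (ℤ → α) → ℤ → α) :=
  continuous_pi fun n => continuous_apply (n + 1)

lemma shift_iterate_apply {α : Type*} (x : ℤ → α) (k : ℕ) (n : ℤ) :
    shift^[k] x n = x (n + k) := by
  induction k generalizing x n with
  | zero => simp
  | succ k ih =>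
    rw [Function.iterate_succ_apply, ih, shift]
    congr 1
    push_cast
    ring

lemma exists_shiftDist_cover {ε : ℝ} (hε : 0 < ε) (N : ℕ) :
    ∃ n : ℕ, ∃ U : Fin n → Set (FullShift a), (∀ i, ROpen (dynDist shift shiftDist N) (U i)) ∧
      (∀ i, setEDiam (dynDist shift shiftDist N) (U i) < ENNReal.ofReal ε) ∧
      Set.univ ⊆ ⋃ i, U i :=
  exists_dynDist_cover continuous_shift continuous_shiftDist shiftDist_self shiftDist_comm
    shiftDist_triangle hε N

lemma dist_coord_lt_of_dynDist_lt {N : ℕ} {ε : ℝ} {x y : FullShift a}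
    (h : dynDist shift shiftDist N x y < ε) {s : ℕ} (hs : s < N) (i : Fin a) :
    |(x s i : ℝ) - y s i| < ε := by
  have h1 := (cubeDist_zero_le_shiftDist (shift^[s] x) (shift^[s] y)).trans
    (le_dynDist shift shiftDist hs x y)
  simp only [shift_iterate_apply, zero_add, cubeDist_eq_dist] at h1
  exact ((dist_le_pi_dist (x s) (y s) i).trans h1).trans_lt h

end ShiftMetric

/-- Fibre coverings extend to the sets of points whose images agree with a given one on a
sufficiently long window. -/
lemma exists_window_cover {X ι α : Type*} [TopologicalSpace X] [CompactSpace X]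
    [UniformSpace α] [CompactSpace α] [T2Space α] {π : X → ι → α} (hπ : Continuous π)
    {𝒰 : Set (Set X)} (hcov : ∀ y, ∃ U ∈ 𝒰, IsOpen U ∧ π ⁻¹' {y} ⊆ U) :
    ∃ I : Finset ι, ∀ y : ι → α, ∃ U ∈ 𝒰, {x | ∀ j ∈ I, π x j = y j} ⊆ U := by
  choose U hU hUo hUc using hcov
  have hWo : ∀ y, IsOpen (π '' (U y)ᶜ)ᶜ := fun y =>
    (hπ.isClosedMap _ (hUo y).isClosed_compl).isOpen_compl
  obtain ⟨V, hV, hVW⟩ := lebesgue_number_lemma (K := (Set.univ : Set (ι → α)))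
    isCompact_univ hWo fun y _ => Set.mem_iUnion.2 ⟨y, by
      rintro ⟨x, hx, rfl⟩
      exact hx (hUc _ rfl)⟩
  rw [Pi.uniformity, Filter.mem_iInf] at hV
  obtain ⟨I, hI, V', hV', rfl⟩ := hV
  refine ⟨hI.toFinset, fun y => ?_⟩
  obtain ⟨y', hy'⟩ := hVW y (Set.mem_univ y)
  refine ⟨U y', hU y', fun x hx => ?_⟩
  by_contra hxU
  refine hy' (?_ : π x ∈ _) ⟨x, hxU, rfl⟩
  refine Set.mem_iInter.2 fun j => ?_
  obtain ⟨t, ht, htV⟩ := Filter.mem_comap.1 (hV' j)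
  refine htV ?_
  have : π x j = y j := hx j (hI.mem_toFinset.2 j.2)
  simp only [Set.mem_preimage, this]
  exact refl_mem_uniformity ht

lemma gridCode_le_add_one {n p : ℕ} (hp : 0 < p) {x x' : Fin n → ℝ} {i : Fin n} (hx' : 0 ≤ x' i)
    (h : x i ≤ x' i + 1 / p) : gridCode p x i ≤ gridCode p x' i + 1 := by
  have hp0 : (0 : ℝ) < p := by exact_mod_cast hp
  rw [gridCode, gridCode, ← Nat.floor_add_one (by positivity)]
  refine Nat.floor_le_floor ?_
  calc (p : ℝ) * x i ≤ p * (x' i + 1 / p) := by gcongr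
    _ = _ := by field_simp

/-- A set whose points agree in each coordinate up to `1 / p` meets few grid cubes. -/
lemma exists_gridCode_finset {n p : ℕ} (hp : 0 < p) {S : Set (Fin n → ℝ)}
    (hS : ∀ x ∈ S, 0 ≤ x) (h : ∀ x ∈ S, ∀ x' ∈ S, ∀ i, x i ≤ x' i + 1 / p) :
    ∃ 𝒴 : Finset (Fin n → ℕ), 𝒴.card ≤ 2 ^ n ∧ ∀ x ∈ S, gridCode p x ∈ 𝒴 := by
  classical
  let m : Fin n → ℕ := fun i => sInf ((fun x => gridCode p x i) '' S)
  refine ⟨Fintype.piFinset fun i => {m i, m i + 1}, ?_, fun x hx => ?_⟩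
  · rw [Fintype.card_piFinset]
    exact (Finset.prod_le_pow_card _ _ 2 fun i _ => Finset.card_le_two).trans_eq (by simp)
  · refine Fintype.mem_piFinset.2 fun i => ?_
    have h1 : m i ≤ gridCode p x i := Nat.sInf_le ⟨x, hx, rfl⟩
    obtain ⟨x', hx', hm⟩ := Nat.sInf_mem (s := (fun x => gridCode p x i) '' S) ⟨_, x, hx, rfl⟩
    have h2 : gridCode p x i ≤ m i + 1 := by
      rw [← show gridCode p x' i = m i from hm]
      exact gridCode_le_add_one hp (hS x' hx' i) (h x hx x' hx' i)
    simp only [Finset.mem_insert, Finset.mem_singleton]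
    omega

/-- The point of the full shift with prescribed coordinates in the window `[0, M)` and zero
coordinates elsewhere. -/
noncomputable def windowPoint (a M : ℕ) (x : Fin (M * a) → ℝ) : FullShift a := fun k i =>
  if h : 0 ≤ k ∧ k.toNat < M then
    Set.projIcc 0 1 zero_le_one (x (finProdFinEquiv (⟨k.toNat, h.2⟩, i)))
  else 0

lemma continuous_windowPoint (a M : ℕ) : Continuous (windowPoint a M) := by
  refine continuous_pi fun k => continuous_pi fun i => ?_
  by_cases h : 0 ≤ k ∧ k.toNat < M
  · simp only [windowPoint, dif_pos h]
    exact continuous_projIcc.comp (continuous_apply _)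
  · simp only [windowPoint, dif_neg h]
    exact continuous_const

lemma windowPoint_apply {a M : ℕ} {x : Fin (M * a) → ℝ} (hx : x ∈ Set.Icc (0 : Fin (M * a) → ℝ) 1)
    (s : Fin M) (i : Fin a) : (windowPoint a M x (s : ℕ) i : ℝ) = x (finProdFinEquiv (s, i)) := by
  have h : (0 : ℤ) ≤ ((s : ℕ) : ℤ) ∧ ((s : ℕ) : ℤ).toNat < M := ⟨by positivity, by simp⟩
  simp only [windowPoint, dif_pos h]
  have : (⟨((s : ℕ) : ℤ).toNat, h.2⟩ : Fin M) = s := by ext; simp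
  rw [this, Set.projIcc_of_mem zero_le_one ⟨hx.1 _, hx.2 _⟩]

lemma map_shift_iterate {a b : ℕ} {π : FullShift a → FullShift b}
    (hequiv : ∀ x, π (shift x) = shift (π x)) (k : ℕ) (x : FullShift a) :
    π (shift^[k] x) = shift^[k] (π x) :=
  (Function.Semiconj.iterate_right (f := π) hequiv k).eq x

/-- Block estimate: the grid volume of a window of `q` blocks of length `N` is controlled by
fibre coverings of a single block. -/
lemma pow_le_of_window_cover {a b N p F L : ℕ} (hp : 0 < p) {ε : ℝ} (hεp : ε ≤ 1 / p)
    {π : FullShift a → FullShift b} (hcont : Continuous π)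
    (hequiv : ∀ x, π (shift x) = shift (π x))
    (hcov : ∀ y : FullShift b, ∃ U : Fin F → Set (FullShift a),
      (∀ i, setEDiam (dynDist shift shiftDist N) (U i) < ENNReal.ofReal ε) ∧
      {x | ∀ j : ℤ, |j| ≤ L → π x j = y j} ⊆ ⋃ i, U i) (q : ℕ) :
    (p : ℝ) ^ (q * N * a) ≤
      2 * 24 ^ (q * N * a) * (F : ℝ) ^ q * p ^ ((q * N + 2 * L + 1) * b) := by
  classical
  set n := q * N * a
  set m := (q * N + 2 * L + 1) * b
  let e : (Fin n → ℝ) → FullShift a := windowPoint a (q * N)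
  let f : (Fin n → ℝ) → Fin m → ℝ := fun x c =>
    (π (e x) (((finProdFinEquiv.symm c).1 : ℕ) - (L : ℤ)) (finProdFinEquiv.symm c).2 : ℝ)
  have hf : Continuous f := by
    refine continuous_pi fun c => continuous_subtype_val.comp ?_
    have : Continuous fun x => π (e x) := hcont.comp (continuous_windowPoint a (q * N))
    exact (continuous_apply _).comp ((continuous_apply _).comp this)
  obtain ⟨y, hy⟩ := exists_fiber_card_gridCode hp hf
  have hfin : ∃ 𝒴 : Finset (Fin n → ℕ), 𝒴.card ≤ F ^ q * 2 ^ n ∧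
      ∀ x ∈ Set.Icc (0 : Fin n → ℝ) 1, f x = y → gridCode p x ∈ 𝒴 := by
    by_cases hne : ∃ x₀, f x₀ = y
    swap
    · exact ⟨∅, by simp, fun x _ hx => (hne ⟨x, hx⟩).elim⟩
    obtain ⟨x₀, hx₀⟩ := hne
    choose U hUd hUc using fun t : Fin q => hcov (shift^[t * N] (π (e x₀)))
    let S : (Fin q → Fin F) → Set (Fin n → ℝ) := fun g =>
      {x | x ∈ Set.Icc (0 : Fin n → ℝ) 1 ∧ ∀ t, shift^[t * N] (e x) ∈ U t (g t)}
    have hS : ∀ g, ∃ 𝒴 : Finset (Fin n → ℕ), 𝒴.card ≤ 2 ^ n ∧ ∀ x ∈ S g, gridCode p x ∈ 𝒴 := by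
      intro g
      refine exists_gridCode_finset hp (fun x hx => hx.1.1) fun x hx x' hx' c => ?_
      obtain ⟨⟨k, i⟩, rfl⟩ := finProdFinEquiv.surjective c
      obtain ⟨⟨t, s⟩, rfl⟩ := finProdFinEquiv.surjective k
      have h1 := dist_coord_lt_of_dynDist_lt
        (dist_lt_of_setEDiam_lt (hUd t (g t)) (hx.2 t) (hx'.2 t)) s.2 i
      have h2 : ((s : ℕ) : ℤ) + ((t * N : ℕ) : ℤ) = ((finProdFinEquiv (t, s) : Fin (q * N)) : ℕ) := by
        simp [finProdFinEquiv, mul_comm]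
      rw [shift_iterate_apply, shift_iterate_apply, h2, windowPoint_apply hx.1,
        windowPoint_apply hx'.1] at h1
      linarith [(abs_lt.1 h1).2]
    choose 𝒴 h𝒴c h𝒴 using hS
    refine ⟨Finset.univ.biUnion 𝒴, ?_, fun x hx hxy => ?_⟩
    · refine (Finset.card_biUnion_le_card_mul _ _ _ fun g _ => h𝒴c g).trans_eq ?_
      simp
    · have hagree : ∀ j : ℤ, -L ≤ j → j ≤ q * N + L → π (e x) j = π (e x₀) j := by
        intro j hj1 hj2
        funext i
        have hlt : (j + L).toNat < q * N + 2 * L + 1 := by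
          zify; rw [Int.toNat_of_nonneg (by linarith)]; linarith
        have := congrFun (hxy.trans hx₀.symm) (finProdFinEquiv (⟨(j + L).toNat, hlt⟩, i))
        simp only [f, Equiv.symm_apply_apply, Int.toNat_of_nonneg (by linarith : 0 ≤ j + L),
          add_sub_cancel_right] at this
        exact Subtype.ext this
      have hmem : ∀ t, ∃ i, shift^[t * N] (e x) ∈ U t i := by
        intro t
        refine Set.mem_iUnion.1 (hUc t fun j hj => ?_)
        rw [map_shift_iterate hequiv, shift_iterate_apply, shift_iterate_apply]
        have h3 : (((t * N : ℕ)) : ℤ) ≤ q * N := by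
          exact_mod_cast Nat.mul_le_mul_right N t.2.le
        have h4 : (0 : ℤ) ≤ ((t * N : ℕ) : ℤ) := by positivity
        refine hagree _ ?_ ?_ <;> linarith [(abs_le.1 hj).1, (abs_le.1 hj).2]
      choose g hg using hmem
      exact Finset.mem_biUnion.2 ⟨g, Finset.mem_univ _, h𝒴 g x ⟨hx, hg⟩⟩
  obtain ⟨𝒴, hc, h𝒴⟩ := hfin
  have hc' : (𝒴.card : ℝ) ≤ F ^ q * 2 ^ n := by exact_mod_cast hc
  calc (p : ℝ) ^ n ≤ 2 * 12 ^ n * 𝒴.card * p ^ m := hy 𝒴 h𝒴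
    _ ≤ 2 * 12 ^ n * (F ^ q * 2 ^ n) * p ^ m := by gcongr
    _ = 2 * (12 ^ n * 2 ^ n) * F ^ q * p ^ m := by ring
    _ = _ := by rw [← mul_pow]; norm_num

lemma exists_window_cover_of_supLogCov {a b N : ℕ} {ε : ℝ} (hε : 0 < ε)
    {π : FullShift a → FullShift b} (hcont : Continuous π) :
    ∃ L : ℕ, ∀ y : FullShift b,
      ∃ U : Fin ⌊Real.exp (supLogCov π (dynDist shift shiftDist N) ε)⌋₊ → Set (FullShift a),
      (∀ i, setEDiam (dynDist shift shiftDist N) (U i) < ENNReal.ofReal ε) ∧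
      {x | ∀ j : ℤ, |j| ≤ L → π x j = y j} ⊆ ⋃ i, U i := by
  set ρ : FullShift a → FullShift a → ℝ := dynDist shift shiftDist N
  set F := ⌊Real.exp (supLogCov π ρ ε)⌋₊
  obtain ⟨I, hI⟩ := exists_window_cover hcont
    (𝒰 := {V | ∃ U : Fin F → Set (FullShift a),
      (∀ i, setEDiam ρ (U i) < ENNReal.ofReal ε) ∧ V = ⋃ i, U i}) (by
    intro y
    have hcov := exists_shiftDist_cover (a := a) hε N
    obtain ⟨U, hUo, hUd, hUc⟩ := covNum_spec hcov (π ⁻¹' {y})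
    have hF : covNum ρ ε (π ⁻¹' {y}) ≤ F := Nat.le_floor (covNum_le_exp_supLogCov hcov π y)
    have hUo' : ∀ i, IsOpen (U i) := fun i =>
      isOpen_of_rOpen continuous_shift continuous_shiftDist shiftDist_self (hUo i)
    let U' : Fin F → Set (FullShift a) := fun i =>
      if h : (i : ℕ) < covNum ρ ε (π ⁻¹' {y}) then U ⟨i, h⟩ else ∅
    refine ⟨⋃ i, U' i, ⟨U', fun i => ?_, rfl⟩, isOpen_iUnion fun i => ?_, fun x hx => ?_⟩
    · by_cases h : (i : ℕ) < covNum ρ ε (π ⁻¹' {y})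
      · simp only [U', dif_pos h]
        exact hUd _
      · simp only [U', dif_neg h]
        simpa [setEDiam] using hε
    · by_cases h : (i : ℕ) < covNum ρ ε (π ⁻¹' {y})
      · simp only [U', dif_pos h]
        exact hUo' _
      · simp only [U', dif_neg h]
        exact isOpen_empty
    · obtain ⟨i, hi⟩ := Set.mem_iUnion.1 (hUc hx)
      refine Set.mem_iUnion.2 ⟨Fin.castLE hF i, ?_⟩
      simpa [U'] using hi)
  refine ⟨I.sup Int.natAbs, fun y => ?_⟩
  obtain ⟨_, ⟨U, hUd, rfl⟩, hUc⟩ := hI y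
  refine ⟨U, hUd, fun x hx => hUc fun j hj => hx j ?_⟩
  rw [Int.abs_eq_natAbs]
  exact_mod_cast Finset.le_sup (f := Int.natAbs) hj

/-- Lower bound for the covering numbers of the fibres of a block map. -/
lemma le_supLogCov {a b N p : ℕ} (hp : 0 < p) {ε : ℝ} (hε : 0 < ε) (hεp : ε ≤ 1 / p)
    {π : FullShift a → FullShift b} (hcont : Continuous π)
    (hequiv : ∀ x, π (shift x) = shift (π x)) :
    (N : ℝ) * (((a : ℝ) - b) * Real.log p - a * Real.log 24) ≤
      supLogCov π (dynDist shift shiftDist N) ε := by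
  set S := supLogCov π (dynDist shift shiftDist N) ε with hS
  obtain ⟨L, hL⟩ := exists_window_cover_of_supLogCov (N := N) hε hcont
  have hp0 : (0 : ℝ) < p := by exact_mod_cast hp
  by_contra! hlt
  set δ := (N : ℝ) * (((a : ℝ) - b) * Real.log p - a * Real.log 24) - S with hδ
  have hδ0 : 0 < δ := by linarith
  obtain ⟨q, hq⟩ := exists_nat_gt ((Real.log 2 + (2 * L + 1) * b * Real.log p) / δ)
  rw [div_lt_iff₀ hδ0] at hq
  have h1 := pow_le_of_window_cover hp hεp hcont hequiv hL q
  have h2 : (p : ℝ) ^ (q * N * a) ≤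
      2 * 24 ^ (q * N * a) * Real.exp S ^ q * p ^ ((q * N + 2 * L + 1) * b) := by
    refine h1.trans ?_
    gcongr
    exact Nat.floor_le (Real.exp_pos S).le
  have h3 := Real.log_le_log (by positivity) h2
  rw [Real.log_mul (by positivity) (by positivity), Real.log_mul (by positivity) (by positivity),
    Real.log_mul (by positivity) (by positivity), Real.log_pow, Real.log_pow, Real.log_pow,
    Real.log_pow, Real.log_exp] at h3
  push_cast at h3
  rw [hδ] at hq
  nlinarith

lemma le_condMdimRate {a b : ℕ} (hab : b ≤ a) {π : FullShift a → FullShift b}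
    (hcont : Continuous π) (hequiv : ∀ x, π (shift x) = shift (π x)) {ε : ℝ} (hε : 0 < ε)
    (hε' : ε < 1 / 2) :
    ((((a : ℝ) - b) - (((a : ℝ) - b) * Real.log 2 + a * Real.log 24) / Real.log (1 / ε) : ℝ) :
      EReal) ≤ condMdimRate π shift shiftDist ε := by
  have hinv : 2 < 1 / ε := by rw [lt_div_iff₀ hε]; linarith
  have hlog : 0 < Real.log (1 / ε) := Real.log_pos (by linarith)
  set p := ⌊1 / ε⌋₊ with hpdef
  have hp2 : 2 ≤ p := Nat.le_floor (by exact_mod_cast hinv.le)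
  have hp0 : (0 : ℝ) < p := by exact_mod_cast (by omega : 0 < p)
  have hεp : ε ≤ 1 / p := by
    rw [le_div_iff₀ hp0, mul_comm, ← le_div_iff₀ hε]
    exact Nat.floor_le (by positivity)
  have hlp : Real.log (1 / ε) - Real.log 2 ≤ Real.log p := by
    rw [← Real.log_div (by positivity) (by norm_num)]
    refine Real.log_le_log (by positivity) ?_
    have := Nat.lt_floor_add_one (1 / ε)
    linarith
  refine le_liminf_of_le (by isBoundedDefault) ?_
  filter_upwards [eventually_ge_atTop 1] with N hN
  have hN0 : (0 : ℝ) < N := by exact_mod_cast hN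
  refine EReal.coe_le_coe_iff.2 ?_
  rw [le_div_iff₀ (by positivity)]
  refine le_trans ?_ (le_supLogCov (N := N) (p := p) (by omega) hε hεp hcont hequiv)
  have hab' : (0 : ℝ) ≤ (a : ℝ) - b := sub_nonneg.2 (by exact_mod_cast hab)
  calc _ = N * (((a : ℝ) - b) * (Real.log (1 / ε) - Real.log 2) - a * Real.log 24) := by
        field_simp; ring
    _ ≤ _ := by gcongr

end WaistInequality

/-- For `a > b`, every equivariant continuous map between the full shifts
`([0,1]^a)^ℤ → ([0,1]^b)^ℤ` has lower conditional metric mean dimension at least `a − b`. -/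
theorem stmt_2 (a b : ℕ) (hab : b < a) (π : FullShift a → FullShift b)
    (hcont : Continuous π) (hequiv : ∀ x, π (shift x) = shift (π x)) :
    (((a : ℝ) - (b : ℝ) : ℝ) : EReal) ≤ lowerCondMdimM π shift shiftDist := by
  set C := ((a : ℝ) - b) * Real.log 2 + a * Real.log 24
  have hlim : Tendsto (fun ε : ℝ => (((a : ℝ) - b) - C / Real.log (1 / ε) : ℝ)) (𝓝[>] 0)
      (𝓝 ((a : ℝ) - b)) := by
    have h1 : Tendsto (fun ε : ℝ => Real.log (1 / ε)) (𝓝[>] 0) atTop := by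
      simp only [one_div]
      exact Real.tendsto_log_atTop.comp tendsto_inv_nhdsGT_zero
    simpa using tendsto_const_nhds.sub (h1.const_div_atTop C)
  have hlim' := (continuous_coe_real_ereal.tendsto _).comp hlim
  rw [lowerCondMdimM, ← hlim'.liminf_eq]
  refine liminf_le_liminf ?_
  filter_upwards [Ioo_mem_nhdsGT (show (0 : ℝ) < 1 / 2 by norm_num)] with ε hε
  exact le_condMdimRate hab.le hcont hequiv hε.1 hε.2
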